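/- Under the hypotheses of the boundary value theorem — σ>1, τ>0, U ⊂ ℝ^d open, Γ ⊆ ℝ^d∖{0} an open cone, γ>0, F : Z → ℂ holomorphic on Z = {z ∈ ℂ^d : Re z ∈ U, Im z ∈ Γ, |Im z| < γ} with |F(z)| ≤ A · exp(T_{(2^σ−1)τ,σ,H}(1/|Im z|)) on Z for some A, H > 0 — let K ⊂ U be compact, let φ : ℝ^d → ℂ be smooth with supp φ ⊆ K and ‖φ‖_{τ/4^{σ-1},σ,h;K} < ∞ for every h>0, let Y ∈ Γ with |Y| < γ, and let V ⊆ ℝ^d∖{0} be an open cone and γ₁>0 such that Y·ξ ≤ −γ₁|ξ| for all ξ ∈ V. Then for every ξ ∈ V the limit û(ξ) = lim_{t→0⁺} ∫_K F(x+itY) φ(x) e^{−i x·ξ} dx exists, and there exist constants B>0 and c>0, independent of ξ, such that |û(ξ)| ≤ B · exp(−T_{(2^σ−1)τ,σ,c}(|ξ|)) for all ξ ∈ V. -/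

import Mathlib

open scoped ENNReal Topology

/-- Partial derivative in the `i`-th coordinate direction of `f : ℝ^d → ℂ`. -/
noncomputable def pder {d : ℕ} (i : Fin d) (f : (Fin d → ℝ) → ℂ) : (Fin d → ℝ) → ℂ :=
  fun x => fderiv ℝ f x (Pi.single i 1)

/-- The length `|α| = α₁ + … + α_d` of a multi-index `α ∈ ℕ^d`. -/
def msize {d : ℕ} (α : Fin d → ℕ) : ℕ := ∑ i, α i

/-- Multi-index partial derivative `∂^α f` of `f : ℝ^d → ℂ`. -/
noncomputable def mder {d : ℕ} (α : Fin d → ℕ) (f : (Fin d → ℝ) → ℂ) : (Fin d → ℝ) → ℂ :=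
  (List.finRange d).foldr (fun i g => (pder i)^[α i] g) f

/-- Euclidean norm on `ℝ^d`. -/
noncomputable def vnorm {d : ℕ} (y : Fin d → ℝ) : ℝ := Real.sqrt (∑ i, y i ^ 2)

/-- The norm `‖φ‖_{τ,σ,h;K} = sup_α sup_{x∈K} |∂^α φ(x)| / (h^{|α|^σ} |α|^{τ|α|^σ})`,
valued in `ℝ≥0∞`; the `α = 0` term is `sup_{x∈K} |φ(x)|`. -/
noncomputable def GNorm {d : ℕ} (τ σ h : ℝ) (K : Set (Fin d → ℝ))
    (φ : (Fin d → ℝ) → ℂ) : ℝ≥0∞ :=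
  ⨆ (α : Fin d → ℕ), ⨆ x ∈ K, ENNReal.ofReal
    (‖mder α φ x‖ /
      (h ^ ((msize α : ℝ) ^ σ) * (msize α : ℝ) ^ (τ * (msize α : ℝ) ^ σ)))

/-- The associated function `T_{τ,σ,h}(k) = sup_{p∈ℕ} ln(h^{p^σ} k^p / p^{τ p^σ})`,
with the `p = 0` term interpreted as `0`. -/
noncomputable def AssocT (τ σ h k : ℝ) : ℝ :=
  ⨆ p : ℕ, Real.log (h ^ ((p : ℝ) ^ σ) * k ^ p / (p : ℝ) ^ (τ * (p : ℝ) ^ σ))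

/-- The function `x ↦ x ^ σ * log x`, the logarithm of `x ^ (x ^ σ)`. -/
noncomputable def powLog (σ x : ℝ) : ℝ := x ^ σ * Real.log x

lemma powLog_nat_nonneg (σ : ℝ) (n : ℕ) : 0 ≤ powLog σ n :=
  mul_nonneg (Real.rpow_nonneg (Nat.cast_nonneg n) σ) (Real.log_natCast_nonneg n)

lemma natCast_rpow_mul_rpow {σ : ℝ} (hσ : 1 < σ) (a : ℝ) (n : ℕ) :
    (n : ℝ) ^ (a * (n : ℝ) ^ σ) = Real.exp (a * powLog σ n) := by
  rcases Nat.eq_zero_or_pos n with rfl | hn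
  · simp [powLog, Real.zero_rpow (show σ ≠ 0 by linarith)]
  · rw [Real.rpow_def_of_pos (by exact_mod_cast hn), powLog]
    ring_nf

/-- Midpoint convexity of `x ^ σ * log x` away from the origin. -/
lemma two_mul_powLog_half_le {σ : ℝ} (hσ : 1 < σ) {x y : ℝ} (hx : 0 ≤ x) (hy : 0 ≤ y)
    (hxy : 2 ≤ x + y) : 2 * powLog σ ((x + y) / 2) ≤ powLog σ x + powLog σ y := by
  have key : ∀ z : ℝ, 0 ≤ z → powLog σ z = σ⁻¹ * (z ^ σ * Real.log (z ^ σ)) := by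
    intro z hz
    rcases hz.eq_or_lt with rfl | hz
    · simp [powLog, Real.zero_rpow (show σ ≠ 0 by linarith)]
    · rw [Real.log_rpow hz, powLog]
      field_simp
  have hσ0 : 0 < σ := by linarith
  rw [key x hx, key y hy, key _ (by linarith)]
  have h1 : ((x + y) / 2) ^ σ ≤ (x ^ σ + y ^ σ) / 2 := by
    have := (convexOn_rpow hσ.le).2 (Set.mem_Ici.2 hx) (Set.mem_Ici.2 hy)
      (show (0 : ℝ) ≤ 1 / 2 by norm_num) (show (0 : ℝ) ≤ 1 / 2 by norm_num) (by norm_num)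
    simp only [smul_eq_mul] at this
    calc _ = (1 / 2 * x + 1 / 2 * y) ^ σ := by ring_nf
      _ ≤ _ := this
      _ = _ := by ring
  have h2 := Real.convexOn_mul_log.2 (Set.mem_Ici.2 (Real.rpow_nonneg hx σ))
    (Set.mem_Ici.2 (Real.rpow_nonneg hy σ))
    (show (0 : ℝ) ≤ 1 / 2 by norm_num) (show (0 : ℝ) ≤ 1 / 2 by norm_num) (by norm_num)
  simp only [smul_eq_mul] at h2
  have h3 : 1 ≤ ((x + y) / 2) ^ σ := Real.one_le_rpow (by linarith) hσ0.le
  have h4 : ((x + y) / 2) ^ σ * Real.log (((x + y) / 2) ^ σ) ≤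
      ((x ^ σ + y ^ σ) / 2) * Real.log ((x ^ σ + y ^ σ) / 2) :=
    mul_le_mul h1 (Real.log_le_log (by linarith) h1) (Real.log_nonneg h3) (by linarith)
  have h5 : 1 / 2 * x ^ σ + 1 / 2 * y ^ σ = (x ^ σ + y ^ σ) / 2 := by ring
  rw [h5] at h2
  have h6 := mul_le_mul_of_nonneg_left (h4.trans h2) (inv_pos.2 hσ0).le
  linarith

lemma powLog_natCast_mono {σ : ℝ} (hσ : 1 < σ) : Monotone fun n : ℕ => powLog σ n := by
  intro m n hmn
  rcases Nat.eq_zero_or_pos m with rfl | hm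
  · simpa [powLog] using powLog_nat_nonneg σ n
  · have hm' : (0 : ℝ) < m := by exact_mod_cast hm
    have : (m : ℝ) ≤ n := by exact_mod_cast hmn
    exact mul_le_mul (Real.rpow_le_rpow hm'.le this (by linarith)) (Real.log_le_log hm' this)
      (Real.log_natCast_nonneg m) (Real.rpow_nonneg (Nat.cast_nonneg n) σ)

lemma exists_powLog_add_le_of_large {σ a b κ : ℝ} (hσ : 1 < σ) (hb : 0 < b) (hba : b < a) :
    ∃ N : ℕ, ∀ n : ℕ, N ≤ n →
      b * powLog σ (n + 1) + κ * ((n : ℝ) + 1) ^ σ ≤ a * ((n : ℝ) ^ σ * Real.log (n / 2)) := by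
  obtain ⟨a', hba', haa'⟩ := exists_between hba
  have ha' : 0 < a' := hb.trans hba'
  have hσ0 : 0 < σ := by linarith
  have h1 : Filter.Tendsto (fun n : ℕ => a * ((n : ℝ) / ((n : ℝ) + 1)) ^ σ) Filter.atTop
      (𝓝 (a * 1 ^ σ)) :=
    ((tendsto_natCast_div_add_atTop (1 : ℝ)).rpow_const (Or.inr hσ0.le)).const_mul a
  rw [Real.one_rpow, mul_one] at h1
  have h2 : Filter.Tendsto (fun n : ℕ => (a' - b) * Real.log ((n : ℝ) + 1)) Filter.atTop
      Filter.atTop :=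
    (Real.tendsto_log_atTop.comp (Filter.tendsto_atTop_add_const_right _ 1
      tendsto_natCast_atTop_atTop)).const_mul_atTop (by linarith)
  have h3 := (h1.eventually_const_lt haa').and ((h2.eventually_ge_atTop (κ + a' * Real.log 3)).and
    (Filter.eventually_ge_atTop 2))
  obtain ⟨N, hN⟩ := Filter.eventually_atTop.1 h3
  refine ⟨N, fun n hn => ?_⟩
  obtain ⟨e1, e2, e3⟩ := hN n hn
  have hn2 : (2 : ℝ) ≤ n := by exact_mod_cast e3
  have hn1 : (0 : ℝ) < (n : ℝ) + 1 := by linarith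
  have hp : 0 < ((n : ℝ) + 1) ^ σ := Real.rpow_pos_of_pos hn1 σ
  rw [Real.div_rpow (by linarith) hn1.le, ← mul_div_assoc, lt_div_iff₀ hp] at e1
  have hl0 : 0 ≤ Real.log ((n : ℝ) / 2) := Real.log_nonneg (by linarith)
  have hl : Real.log ((n : ℝ) + 1) - Real.log 3 ≤ Real.log ((n : ℝ) / 2) := by
    rw [← Real.log_div hn1.ne' (by norm_num)]
    exact Real.log_le_log (by positivity) (by linarith)
  have e4 : b * Real.log ((n : ℝ) + 1) + κ ≤ a' * Real.log (n / 2) := by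
    have := mul_le_mul_of_nonneg_left hl ha'.le
    nlinarith
  calc b * powLog σ (n + 1) + κ * ((n : ℝ) + 1) ^ σ
      = ((n : ℝ) + 1) ^ σ * (b * Real.log ((n : ℝ) + 1) + κ) := by rw [powLog]; ring
    _ ≤ ((n : ℝ) + 1) ^ σ * (a' * Real.log (n / 2)) := by gcongr
    _ = (a' * ((n : ℝ) + 1) ^ σ) * Real.log (n / 2) := by ring
    _ ≤ (a * (n : ℝ) ^ σ) * Real.log (n / 2) := by gcongr
    _ = _ := by ring

lemma div_four_rpow_lt {σ τ : ℝ} (hσ : 1 < σ) (hτ : 0 < τ) :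
    τ / (4 : ℝ) ^ (σ - 1) < ((2 : ℝ) ^ σ - 1) * τ * 2 ^ (1 - σ) := by
  have h1 : (1 : ℝ) < 2 ^ (σ - 1) := Real.one_lt_rpow (by norm_num) (by linarith)
  have h4 : (4 : ℝ) ^ (σ - 1) = 2 ^ (σ - 1) * 2 ^ (σ - 1) := by
    rw [← Real.mul_rpow (by norm_num) (by norm_num)]; norm_num
  have h2 : (2 : ℝ) ^ σ = 2 * 2 ^ (σ - 1) := by
    rw [Real.rpow_sub (by norm_num)]; norm_num; ring
  have h3 : (2 : ℝ) ^ (1 - σ) = (2 ^ (σ - 1))⁻¹ := by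
    rw [← Real.rpow_neg (by norm_num)]; ring_nf
  rw [h4, h2, h3]
  set x := (2 : ℝ) ^ (σ - 1)
  have hx : 0 < x := by linarith
  rw [div_lt_iff₀ (by positivity)]
  have : (2 * x - 1) * τ * x⁻¹ * (x * x) = (2 * x - 1) * x * τ := by field_simp
  rw [this]
  have : 1 < (2 * x - 1) * x := by nlinarith
  nlinarith

/-- The key comparison of defining sequences: the sequence with parameter `τ / 4 ^ (σ - 1)`,
evaluated at a sum, is dominated by the product of sequences with parameter `(2 ^ σ - 1) τ`,
with room to spare for exponential factors. -/
lemma exists_powLog_add_le {σ τ : ℝ} (hσ : 1 < σ) (hτ : 0 < τ) {κ : ℝ} (hκ : 0 ≤ κ) :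
    ∃ M : ℝ, ∀ j p : ℕ,
      τ / (4 : ℝ) ^ (σ - 1) * powLog σ ((j + p + 1 : ℕ)) + κ * ((j + p + 1 : ℕ) : ℝ) ^ σ ≤
        ((2 : ℝ) ^ σ - 1) * τ * (powLog σ j + powLog σ p) + M := by
  set b := τ / (4 : ℝ) ^ (σ - 1)
  set τ' := ((2 : ℝ) ^ σ - 1) * τ
  have hb : 0 < b := by positivity
  have h2σ : (1 : ℝ) < 2 ^ σ := Real.one_lt_rpow (by norm_num) (by linarith)
  have hτ' : 0 < τ' := mul_pos (by linarith) hτ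
  obtain ⟨N, hN⟩ := exists_powLog_add_le_of_large (κ := κ) hσ hb (div_four_rpow_lt hσ hτ)
  refine ⟨b * powLog σ ((N + 2 + 1 : ℕ)) + κ * ((N + 2 + 1 : ℕ) : ℝ) ^ σ, fun j p => ?_⟩
  have hM : 0 ≤ b * powLog σ ((N + 2 + 1 : ℕ)) + κ * ((N + 2 + 1 : ℕ) : ℝ) ^ σ :=
    add_nonneg (mul_nonneg hb.le (powLog_nat_nonneg _ _)) (by positivity)
  have hR : 0 ≤ τ' * (powLog σ j + powLog σ p) :=
    mul_nonneg hτ'.le (add_nonneg (powLog_nat_nonneg _ _) (powLog_nat_nonneg _ _))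
  rcases le_total (j + p) (N + 2) with h | h
  · have h1 : powLog σ ((j + p + 1 : ℕ)) ≤ powLog σ ((N + 2 + 1 : ℕ)) :=
      powLog_natCast_mono hσ (by omega)
    have h2 : ((j + p + 1 : ℕ) : ℝ) ^ σ ≤ ((N + 2 + 1 : ℕ) : ℝ) ^ σ :=
      Real.rpow_le_rpow (Nat.cast_nonneg _) (by exact_mod_cast (by omega)) (by linarith)
    have := mul_le_mul_of_nonneg_left h1 hb.le
    have := mul_le_mul_of_nonneg_left h2 hκ
    linarith
  · have h1 := hN (j + p) (by omega)
    have hjp : (2 : ℝ) ≤ (j : ℝ) + p := by exact_mod_cast (show 2 ≤ j + p by omega)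
    have h2 := two_mul_powLog_half_le hσ (Nat.cast_nonneg j) (Nat.cast_nonneg p) hjp
    have h3 : 2 * powLog σ (((j : ℝ) + p) / 2) =
        2 ^ (1 - σ) * (((j : ℝ) + p) ^ σ * Real.log (((j : ℝ) + p) / 2)) := by
      rw [powLog, Real.div_rpow (by linarith) (by norm_num), Real.rpow_sub (by norm_num),
        Real.rpow_one]
      ring
    have h4 := mul_le_mul_of_nonneg_left h2 hτ'.le
    rw [h3] at h4
    rw [mul_assoc τ' ((2 : ℝ) ^ (1 - σ))] at h1
    push_cast at h1 hM ⊢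
    linarith

/-- The log-convex weight sequence `β ^ n * n ^ (b * n ^ σ)`. -/
noncomputable def gevreyWeight (β b σ : ℝ) (n : ℕ) : ℝ := β ^ n * Real.exp (b * powLog σ n)

/-- The quotients of consecutive weights. -/
noncomputable def weightNode (β b σ : ℝ) (n : ℕ) : ℝ :=
  gevreyWeight β b σ n / gevreyWeight β b σ (n + 1)

section Weight

variable {β b σ : ℝ}

lemma gevreyWeight_pos (hβ : 0 < β) (n : ℕ) : 0 < gevreyWeight β b σ n := by
  unfold gevreyWeight; positivity

lemma weightNode_pos (hβ : 0 < β) (n : ℕ) : 0 < weightNode β b σ n :=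
  div_pos (gevreyWeight_pos hβ n) (gevreyWeight_pos hβ (n + 1))

lemma weightNode_eq (hβ : 0 < β) (n : ℕ) :
    weightNode β b σ n = β⁻¹ * Real.exp (-(b * (powLog σ (n + 1 : ℕ) - powLog σ n))) := by
  rw [weightNode, gevreyWeight, gevreyWeight, pow_succ,
    show -(b * (powLog σ (n + 1 : ℕ) - powLog σ n)) =
      b * powLog σ n - b * powLog σ (n + 1 : ℕ) by ring, Real.exp_sub]
  field_simp

lemma weightNode_antitone (hβ : 0 < β) (hb : 0 < b) (hσ : 1 < σ) :
    Antitone (weightNode β b σ) := by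
  refine antitone_nat_of_succ_le fun n => ?_
  rw [weightNode_eq hβ, weightNode_eq hβ]
  have h := two_mul_powLog_half_le hσ (Nat.cast_nonneg n) (Nat.cast_nonneg (n + 1 + 1))
    (by push_cast; linarith [Nat.cast_nonneg (α := ℝ) n])
  rw [show ((n : ℝ) + ((n + 1 + 1 : ℕ) : ℝ)) / 2 = ((n + 1 : ℕ) : ℝ) by push_cast; ring] at h
  have : b * (powLog σ (n + 1 : ℕ) - powLog σ n) ≤
      b * (powLog σ (n + 1 + 1 : ℕ) - powLog σ (n + 1 : ℕ)) :=
    mul_le_mul_of_nonneg_left (by linarith) hb.le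
  gcongr

lemma tendsto_weightNode (hβ : 0 < β) (hb : 0 < b) (hσ : 1 < σ) :
    Filter.Tendsto (weightNode β b σ) Filter.atTop (𝓝 0) := by
  have h1 : ∀ n : ℕ, Real.log (n + 1 : ℕ) ≤ powLog σ (n + 1 : ℕ) - powLog σ n := by
    intro n
    have hc : (n : ℝ) ^ σ + 1 ≤ ((n + 1 : ℕ) : ℝ) ^ σ := by
      have := Real.add_rpow_le_rpow_add (Nat.cast_nonneg (α := ℝ) n) zero_le_one hσ.le
      rw [Real.one_rpow] at this
      exact_mod_cast this
    have h0 : (0 : ℝ) ≤ Real.log (n + 1 : ℕ) := Real.log_natCast_nonneg _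
    have h2 : powLog σ n ≤ (n : ℝ) ^ σ * Real.log (n + 1 : ℕ) := by
      rcases Nat.eq_zero_or_pos n with rfl | hn
      · simp [powLog]
      · exact mul_le_mul_of_nonneg_left
          (Real.log_le_log (by exact_mod_cast hn) (by push_cast; linarith))
          (Real.rpow_nonneg (Nat.cast_nonneg n) σ)
    have h3 := mul_le_mul_of_nonneg_right hc h0
    rw [powLog]
    linarith
  have h2 : Filter.Tendsto (fun n : ℕ => b * Real.log (n + 1 : ℕ)) Filter.atTop Filter.atTop :=
    (Real.tendsto_log_atTop.comp (tendsto_natCast_atTop_atTop.comp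
      (Filter.tendsto_add_atTop_nat 1))).const_mul_atTop hb
  have h3 := Filter.tendsto_atTop_mono (fun n => mul_le_mul_of_nonneg_left (h1 n) hb.le) h2
  have h4 := (Real.tendsto_exp_neg_atTop_nhds_zero.comp h3).const_mul β⁻¹
  rw [mul_zero] at h4
  exact h4.congr fun n => (weightNode_eq hβ n).symm

/-- Between consecutive nodes, the weighted powers `W r * s ^ r` are minimal at `r = n + 1`. -/
lemma gevreyWeight_mul_pow_le (hβ : 0 < β) (hb : 0 < b) (hσ : 1 < σ) {n : ℕ} {s : ℝ}
    (h1 : weightNode β b σ (n + 1) ≤ s) (h2 : s ≤ weightNode β b σ n) (r : ℕ) :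
    gevreyWeight β b σ (n + 1) * s ^ (n + 1) ≤ gevreyWeight β b σ r * s ^ r := by
  have hs : 0 < s := (weightNode_pos hβ _).trans_le h1
  rcases le_total (n + 1) r with hr | hr
  · induction r, hr using Nat.le_induction with
    | base => rfl
    | succ r hr ih =>
      refine ih.trans ?_
      have h3 : weightNode β b σ r ≤ s := (weightNode_antitone hβ hb hσ hr).trans h1
      rw [weightNode, div_le_iff₀ (gevreyWeight_pos hβ _)] at h3
      rw [pow_succ, ← mul_assoc, mul_right_comm]
      rw [mul_comm] at h3
      exact mul_le_mul_of_nonneg_right h3 (by positivity)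
  · induction hr using Nat.decreasingInduction with
    | self => rfl
    | of_succ r hr ih =>
      refine ih.trans ?_
      have h3 : s ≤ weightNode β b σ r := h2.trans (weightNode_antitone hβ hb hσ (by omega))
      rw [weightNode, le_div_iff₀ (gevreyWeight_pos hβ _)] at h3
      rw [pow_succ, ← mul_assoc, mul_right_comm]
      rw [mul_comm] at h3
      exact mul_le_mul_of_nonneg_right h3 (by positivity)

lemma gevreyWeight_mul_pow_le_succ (hβ : 0 < β) (hb : 0 < b) (hσ : 1 < σ) {n : ℕ} {s : ℝ}
    (h1 : weightNode β b σ (n + 1) ≤ s) (h2 : s ≤ weightNode β b σ n) (r : ℕ) :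
    gevreyWeight β b σ (n + 1) * s ^ n ≤ gevreyWeight β b σ (r + 1) * s ^ r := by
  have hs : 0 < s := (weightNode_pos hβ _).trans_le h1
  have h := gevreyWeight_mul_pow_le hβ hb hσ h1 h2 (r + 1)
  rw [pow_succ, pow_succ, ← mul_assoc, ← mul_assoc] at h
  exact le_of_mul_le_mul_right h hs

lemma gevreyWeight_zero_le (hβ : 0 < β) (hb : 0 < b) (hσ : 1 < σ) (hs1 : weightNode β b σ 0 ≤ 1)
    (r : ℕ) : gevreyWeight β b σ 0 ≤ gevreyWeight β b σ (r + 1) * weightNode β b σ 0 ^ r := by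
  have hs : 0 < weightNode β b σ 0 := weightNode_pos hβ 0
  have h := gevreyWeight_mul_pow_le_succ hβ hb hσ (weightNode_antitone hβ hb hσ (Nat.zero_le 1))
    le_rfl r
  refine le_trans ?_ h
  have hW := gevreyWeight_pos (b := b) (σ := σ) hβ 1
  have h0 : gevreyWeight β b σ 0 = weightNode β b σ 0 * gevreyWeight β b σ 1 := by
    rw [weightNode, zero_add, div_mul_cancel₀ _ hW.ne']
  rw [pow_zero, mul_one, h0, zero_add]
  exact mul_le_of_le_one_left hW.le hs1

end Weight

lemma exp_assocT_mul_le {τ σ h k X Z : ℝ} (hσ : 1 < σ) (hh : 0 < h) (hk : 0 < k) (hX : 0 ≤ X)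
    (hZ : 0 ≤ Z)
    (H : ∀ j : ℕ, h ^ ((j : ℝ) ^ σ) * k ^ j / (j : ℝ) ^ (τ * (j : ℝ) ^ σ) * X ≤ Z) :
    Real.exp (AssocT τ σ h k) * X ≤ Z := by
  rcases hX.eq_or_lt with rfl | hX
  · simpa using hZ
  have hpos : ∀ j : ℕ, 0 < h ^ ((j : ℝ) ^ σ) * k ^ j / (j : ℝ) ^ (τ * (j : ℝ) ^ σ) := by
    intro j
    rw [natCast_rpow_mul_rpow hσ]
    positivity
  have hZ' : 0 < Z := (mul_pos (hpos 1) hX).trans_le (H 1)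
  rw [← le_div_iff₀ hX, ← Real.le_log_iff_exp_le (by positivity)]
  refine ciSup_le fun j => Real.log_le_log (hpos j) ?_
  rw [le_div_iff₀ hX]
  exact H j

lemma pow_le_exp_abs_log_mul {x R : ℝ} (hx : 0 < x) {j : ℕ} (hj : (j : ℝ) ≤ R) :
    x ^ j ≤ Real.exp (|Real.log x| * R) := by
  rw [← Real.exp_log (pow_pos hx j), Real.log_pow, Real.exp_le_exp, mul_comm]
  exact mul_le_mul (le_abs_self _) hj (Nat.cast_nonneg j) (abs_nonneg _)

lemma rpow_le_exp_abs_log_mul {x y R : ℝ} (hx : 0 < x) (hy : 0 ≤ y) (hj : y ≤ R) :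
    x ^ y ≤ Real.exp (|Real.log x| * R) := by
  rw [Real.rpow_def_of_pos hx, Real.exp_le_exp]
  exact mul_le_mul (le_abs_self _) hj hy (abs_nonneg _)

lemma factorial_le_exp_rpow {σ R : ℝ} (hσ : 1 < σ) {p : ℕ} (hp : (p : ℝ) ^ σ ≤ R) :
    (p.factorial : ℝ) ≤ Real.exp (1 / (σ - 1) * R) := by
  rcases Nat.eq_zero_or_pos p with rfl | hp0
  · rw [Nat.factorial_zero, Nat.cast_one, Real.one_le_exp_iff]
    have h1 : 0 < σ - 1 := by linarith
    have h2 : 0 ≤ R := le_trans (by positivity) hp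
    positivity
  have hp' : (0 : ℝ) < p := by exact_mod_cast hp0
  have hσ' : 0 < σ - 1 := by linarith
  calc (p.factorial : ℝ) ≤ (p : ℝ) ^ p := by exact_mod_cast Nat.factorial_le_pow p
    _ = Real.exp (p * Real.log p) := by
      rw [← Real.log_pow, Real.exp_log (by positivity)]
    _ ≤ Real.exp (1 / (σ - 1) * R) := by
      rw [Real.exp_le_exp]
      calc (p : ℝ) * Real.log p ≤ p * ((p : ℝ) ^ (σ - 1) / (σ - 1)) := by
            gcongr; exact Real.log_le_rpow_div hp'.le hσ'
        _ = 1 / (σ - 1) * (p : ℝ) ^ σ := by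
            rw [Real.rpow_sub hp', Real.rpow_one]; field_simp
        _ ≤ _ := by gcongr

/-- The growth `exp T(1 / (s y))` of the holomorphic function times the decay of the optimally
truncated remainder is controlled, uniformly in `s`, with loss `s ^ (-p)`. -/
lemma exists_exp_assocT_mul_le {σ τ H y g β : ℝ} (hσ : 1 < σ) (hτ : 0 < τ) (hH : 0 < H)
    (hy : 0 < y) (hg : 0 < g) (hβ : 0 < β) :
    ∃ B : ℝ, 0 < B ∧ ∀ s : ℝ, 0 < s → ∀ X : ℝ, 0 ≤ X →
      (∀ r : ℕ, X ≤ gevreyWeight β (τ / (4 : ℝ) ^ (σ - 1)) σ (r + 1) * s ^ r) → ∀ p : ℕ,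
      Real.exp (AssocT (((2 : ℝ) ^ σ - 1) * τ) σ H (1 / (s * y))) *
        (X * (p.factorial / (s * g) ^ p)) ≤
          B * Real.exp (((2 : ℝ) ^ σ - 1) * τ * powLog σ p) := by
  set b := τ / (4 : ℝ) ^ (σ - 1)
  set τ' := ((2 : ℝ) ^ σ - 1) * τ
  set κ := |Real.log H| + |Real.log y⁻¹| + 1 / (σ - 1) + |Real.log g⁻¹| + |Real.log β|
  have hσ1 : 0 < σ - 1 := by linarith
  obtain ⟨M, hM⟩ := exists_powLog_add_le hσ hτ (show 0 ≤ κ by positivity)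
  refine ⟨Real.exp M, Real.exp_pos _, fun s hs X hX hXW p => ?_⟩
  refine exp_assocT_mul_le hσ hH (by positivity) (by positivity) (by positivity) fun j => ?_
  rw [natCast_rpow_mul_rpow hσ]
  set r := j + p + 1 with hr
  set R := (r : ℝ) ^ σ with hR
  have hr1 : (1 : ℝ) ≤ r := by exact_mod_cast (by omega)
  have hrR : (r : ℝ) ≤ R := by
    simpa using Real.rpow_le_rpow_of_exponent_le hr1 hσ.le
  have hjr : (j : ℝ) ≤ r := by exact_mod_cast (by omega)
  have hpr : (p : ℝ) ≤ r := by exact_mod_cast (by omega)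
  have hjR : (j : ℝ) ^ σ ≤ R := Real.rpow_le_rpow (Nat.cast_nonneg j) hjr (by linarith)
  have hpR : (p : ℝ) ^ σ ≤ R := Real.rpow_le_rpow (Nat.cast_nonneg p) hpr (by linarith)
  have f1 := rpow_le_exp_abs_log_mul hH (Real.rpow_nonneg (Nat.cast_nonneg j) σ) hjR
  have f2 := pow_le_exp_abs_log_mul (inv_pos.2 hy) (hjr.trans hrR)
  have f3 := factorial_le_exp_rpow hσ hpR
  have f4 := pow_le_exp_abs_log_mul (inv_pos.2 hg) (hpr.trans hrR)
  have f5 := pow_le_exp_abs_log_mul hβ hrR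
  have hX' := hXW (j + p)
  rw [← hr, gevreyWeight] at hX'
  calc H ^ ((j : ℝ) ^ σ) * (1 / (s * y)) ^ j / Real.exp (τ' * powLog σ j) *
        (X * (p.factorial / (s * g) ^ p))
      ≤ H ^ ((j : ℝ) ^ σ) * (1 / (s * y)) ^ j / Real.exp (τ' * powLog σ j) *
        (β ^ r * Real.exp (b * powLog σ r) * s ^ (j + p) * (p.factorial / (s * g) ^ p)) := by
        gcongr
    _ = H ^ ((j : ℝ) ^ σ) * y⁻¹ ^ j * p.factorial * g⁻¹ ^ p * β ^ r *
          (Real.exp (b * powLog σ r) / Real.exp (τ' * powLog σ j)) := by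
        have e1 : (1 / (s * y)) ^ j = (s ^ j)⁻¹ * y⁻¹ ^ j := by
          rw [one_div, mul_inv, mul_pow, inv_pow]
        rw [pow_add s, e1, mul_pow, inv_pow g]
        field_simp
    _ ≤ Real.exp (|Real.log H| * R) * Real.exp (|Real.log y⁻¹| * R) *
          Real.exp (1 / (σ - 1) * R) * Real.exp (|Real.log g⁻¹| * R) *
          Real.exp (|Real.log β| * R) *
          (Real.exp (b * powLog σ r) / Real.exp (τ' * powLog σ j)) := by
        gcongr
    _ = Real.exp (κ * R + b * powLog σ r - τ' * powLog σ j) := by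
        rw [Real.exp_sub, Real.exp_add]
        simp only [κ, add_mul, Real.exp_add]
        ring
    _ ≤ Real.exp (M + τ' * powLog σ p) := by
        rw [Real.exp_le_exp]
        have := hM j p
        rw [← hr, ← hR] at this
        linarith
    _ = _ := Real.exp_add _ _

section Osgood

variable {d : ℕ} {F : (Fin d → ℂ) → ℂ} {Z : Set (Fin d → ℂ)}

/-- The complex partial derivative of `F` in the variable `j`. -/
noncomputable def cpder (F : (Fin d → ℂ) → ℂ) (j : Fin d) (z : Fin d → ℂ) : ℂ :=
  deriv (fun w => F (Function.update z j w)) (z j)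

lemma update_mem_ball {z u : Fin d → ℂ} {r : ℝ} (hr : 0 < r) (hu : u ∈ Metric.ball z r)
    (a : Fin d) {ζ : ℂ} (hζ : ζ ∈ Metric.ball (z a) r) :
    Function.update u a ζ ∈ Metric.ball z r := by
  rw [Metric.mem_ball, dist_pi_lt_iff hr] at *
  intro b
  rcases eq_or_ne b a with rfl | h
  · simpa using hζ
  · simpa [h] using hu b

lemma piecewise_mem_ball {z u : Fin d → ℂ} {r : ℝ} (hr : 0 < r) (hu : u ∈ Metric.ball z r)
    (T : Finset (Fin d)) : T.piecewise u z ∈ Metric.ball z r := by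
  rw [Metric.mem_ball, dist_pi_lt_iff hr] at *
  intro b
  by_cases h : b ∈ T
  · simpa [h] using hu b
  · simpa [h] using hr

lemma piecewise_eq_update {T : Finset (Fin d)} {a : Fin d} (ha : a ∉ T) (u z : Fin d → ℂ) :
    T.piecewise u z = Function.update (T.piecewise u z) a (z a) := by
  symm
  rw [Function.update_eq_self_iff]
  simp [ha]

lemma hasDerivAt_slice
    (hsep : ∀ z ∈ Z, ∀ j, AnalyticAt ℂ (fun w : ℂ => F (Function.update z j w)) (z j))
    {u : Fin d → ℂ} {a : Fin d} {ζ : ℂ} (h : Function.update u a ζ ∈ Z) :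
    HasDerivAt (fun w => F (Function.update u a w)) (cpder F a (Function.update u a ζ)) ζ := by
  have := hsep _ h a
  simp only [Function.update_idem, Function.update_self] at this
  have h2 := this.differentiableAt.hasDerivAt
  simpa [cpder] using h2

/-- Separately holomorphic and locally bounded functions are continuous. -/
lemma continuousAt_of_separately_analytic (hZ : IsOpen Z)
    (hsep : ∀ z ∈ Z, ∀ j, AnalyticAt ℂ (fun w : ℂ => F (Function.update z j w)) (z j))
    (hbdd : ∀ z ∈ Z, ∃ M, ∀ᶠ w in 𝓝 z, ‖F w‖ ≤ M) {z : Fin d → ℂ} (hz : z ∈ Z) :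
    ContinuousAt F z := by
  obtain ⟨M, hM⟩ := hbdd z hz
  obtain ⟨r, hr, hball⟩ := Metric.eventually_nhds_iff_ball.1 (hM.and (hZ.eventually_mem hz))
  have hM0 : 0 ≤ M := (norm_nonneg _).trans (hball z (Metric.mem_ball_self hr)).1
  have key : ∀ T : Finset (Fin d),
      Filter.Tendsto (fun u => F (T.piecewise u z)) (𝓝 z) (𝓝 (F z)) := by
    intro T
    induction T using Finset.induction_on with
    | empty => simp
    | insert a T ha ih =>
      have hsub : Filter.Tendsto (fun u => F ((insert a T).piecewise u z) - F (T.piecewise u z))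
          (𝓝 z) (𝓝 0) := by
        have hlim : Filter.Tendsto (fun u : Fin d → ℂ => (2 * M + 1) / r * dist (u a) (z a))
            (𝓝 z) (𝓝 0) := by
          have : Continuous fun u : Fin d → ℂ => (2 * M + 1) / r * dist (u a) (z a) := by fun_prop
          simpa using this.tendsto z
        refine squeeze_zero_norm' ?_ hlim
        filter_upwards [Metric.ball_mem_nhds z hr] with u hu
        set v := T.piecewise u z with hv
        have hvb : v ∈ Metric.ball z r := piecewise_mem_ball hr hu T
        have hua : u a ∈ Metric.ball (z a) r := (dist_le_pi_dist u z a).trans_lt hu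
        rw [Finset.piecewise_insert, ← hv, ← dist_eq_norm]
        nth_rewrite 2 [hv]
        rw [piecewise_eq_update ha u z, ← hv]
        refine Complex.dist_le_div_mul_dist_of_mapsTo_ball
          (f := fun w => F (Function.update v a w)) ?_ ?_ hua
        · intro ζ hζ
          exact (hasDerivAt_slice hsep
            (hball _ (update_mem_ball hr hvb a hζ)).2).differentiableAt.differentiableWithinAt
        · intro ζ hζ
          have h1 := (hball _ (update_mem_ball hr hvb a hζ)).1
          have h2 := (hball _ (update_mem_ball hr hvb a (Metric.mem_ball_self hr))).1
          have h3 := norm_sub_le (F (Function.update v a ζ)) (F (Function.update v a (z a)))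
          rw [Metric.mem_closedBall, dist_eq_norm]
          linarith
      simpa using hsub.add ih
  simpa [ContinuousAt] using key Finset.univ

lemma continuousAt_cpder (hZ : IsOpen Z)
    (hsep : ∀ z ∈ Z, ∀ j, AnalyticAt ℂ (fun w : ℂ => F (Function.update z j w)) (z j))
    (hcont : ContinuousOn F Z) (a : Fin d) {z : Fin d → ℂ} (hz : z ∈ Z) :
    ContinuousAt (cpder F a) z := by
  obtain ⟨r, hr, hball⟩ := Metric.isOpen_iff.1 hZ z hz
  have hr2 : 0 < r / 2 := by positivity
  have hr4 : 0 < r / 4 := by positivity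
  have hmem : ∀ u ∈ Metric.ball z r, ∀ ζ ∈ Metric.closedBall (z a) (r / 2),
      Function.update u a ζ ∈ Z := fun u hu ζ hζ => hball (update_mem_ball hr hu a
        (Metric.closedBall_subset_ball (by linarith) hζ))
  have hfz : ContinuousAt (deriv fun w => F (Function.update z a w)) (z a) :=
    (hsep z hz a).deriv.continuousAt
  rw [Metric.continuousAt_iff'] at hfz ⊢
  intro ε hε
  have hunif := (isCompact_closedBall (z a) (r / 2)).mem_uniformity_of_prod
    (f := fun u ζ => F (Function.update u a ζ)) (s := Metric.ball z r) (q := z)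
    (hcont.comp (f := fun q : (Fin d → ℂ) × ℂ => Function.update q.1 a q.2)
      (Continuous.continuousOn (by fun_prop)) (fun q hq => hmem q.1 hq.1 q.2 hq.2))
    (Metric.mem_ball_self hr) (Metric.dist_mem_uniformity (show 0 < ε / 3 * (r / 4) by positivity))
  obtain ⟨v, hv, hvu⟩ := hunif
  rw [Metric.isOpen_ball.nhdsWithin_eq (Metric.mem_ball_self hr)] at hv
  have hpr : Filter.Tendsto (fun u : Fin d → ℂ => u a) (𝓝 z) (𝓝 (z a)) :=
    (continuous_apply a).tendsto z
  filter_upwards [hv, Metric.ball_mem_nhds z hr4, hpr.eventually (hfz (ε / 2) (by positivity))]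
    with u hu hub huz
  have hua : dist (u a) (z a) < r / 4 := (dist_le_pi_dist u z a).trans_lt hub
  have hub' : u ∈ Metric.ball z r := Metric.ball_subset_ball (by linarith) hub
  have hsub : Metric.closedBall (u a) (r / 4) ⊆ Metric.closedBall (z a) (r / 2) :=
    Metric.closedBall_subset_closedBall' (by linarith)
  have hd : ∀ w ∈ Metric.ball z r, ∀ ζ ∈ Metric.closedBall (u a) (r / 4),
      DifferentiableAt ℂ (fun x => F (Function.update w a x)) ζ := fun w hw ζ hζ =>
    (hasDerivAt_slice hsep (hmem w hw ζ (hsub hζ))).differentiableAt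
  have huc : u a ∈ Metric.closedBall (u a) (r / 4) := Metric.mem_closedBall_self hr4.le
  have hz' := Metric.mem_ball_self hr (x := z)
  have hcauchy : ‖deriv (fun x => F (Function.update u a x) - F (Function.update z a x)) (u a)‖ ≤
      ε / 3 * (r / 4) / (r / 4) := by
    refine Complex.norm_deriv_le_of_forall_mem_sphere_norm_le hr4 ?_ ?_
    · refine DifferentiableOn.diffContOnCl fun ζ hζ => ?_
      have hζ' := Metric.closure_ball_subset_closedBall hζ
      exact ((hd u hub' ζ hζ').sub (hd z hz' ζ hζ')).differentiableWithinAt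
    · intro ζ hζ
      have := hvu u hu ζ (hsub (Metric.sphere_subset_closedBall hζ))
      rw [← dist_eq_norm]
      exact le_of_lt this
  rw [mul_div_cancel_right₀ _ hr4.ne', deriv_fun_sub (hd u hub' _ huc) (hd z hz' _ huc)] at hcauchy
  have h1 : dist (cpder F a u) (deriv (fun w => F (Function.update z a w)) (u a)) ≤ ε / 3 := by
    rw [dist_eq_norm]; exact hcauchy
  have h2 := dist_triangle (cpder F a u) (deriv (fun w => F (Function.update z a w)) (u a))
    (cpder F a z)
  have h3 : dist (deriv (fun w => F (Function.update z a w)) (u a)) (cpder F a z) < ε / 2 := huz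
  linarith

/-- **Osgood's lemma**: a separately holomorphic function with continuous partial derivatives is
complex differentiable. -/
lemma hasFDerivAt_of_separately_analytic (hZ : IsOpen Z)
    (hsep : ∀ z ∈ Z, ∀ j, AnalyticAt ℂ (fun w : ℂ => F (Function.update z j w)) (z j))
    (hbdd : ∀ z ∈ Z, ∃ M, ∀ᶠ w in 𝓝 z, ‖F w‖ ≤ M) {z : Fin d → ℂ} (hz : z ∈ Z) :
    HasFDerivAt F (∑ j, cpder F j z • ContinuousLinearMap.proj (R := ℂ) (φ := fun _ => ℂ) j) z := by
  have hcont : ContinuousOn F Z := fun w hw =>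
    (continuousAt_of_separately_analytic hZ hsep hbdd hw).continuousWithinAt
  have key : ∀ T : Finset (Fin d),
      (fun u : Fin d → ℂ => F (T.piecewise u z) - F z - ∑ j ∈ T, cpder F j z * (u j - z j))
        =o[𝓝 z] fun u => u - z := by
    intro T
    induction T using Finset.induction_on with
    | empty => simp
    | insert a T ha ih =>
      have hsub : (fun u : Fin d → ℂ => F ((insert a T).piecewise u z) - F (T.piecewise u z)
          - cpder F a z * (u a - z a)) =o[𝓝 z] fun u => u - z := by
        rw [Asymptotics.isLittleO_iff]
        intro ε hε
        have hc := Metric.continuousAt_iff'.1 (continuousAt_cpder hZ hsep hcont a hz) ε hε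
        obtain ⟨r, hr, hball⟩ := Metric.eventually_nhds_iff_ball.1 (hc.and (hZ.eventually_mem hz))
        filter_upwards [Metric.ball_mem_nhds z hr] with u hu
        set v := T.piecewise u z with hv
        have hvb : v ∈ Metric.ball z r := piecewise_mem_ball hr hu T
        have hua : u a ∈ Metric.ball (z a) r := (dist_le_pi_dist u z a).trans_lt hu
        have hmv := (convex_ball (z a) r).norm_image_sub_le_of_norm_hasDerivWithin_le
          (f := fun ζ => F (Function.update v a ζ) - cpder F a z * ζ)
          (f' := fun ζ => cpder F a (Function.update v a ζ) - cpder F a z) (C := ε)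
          (fun ζ hζ => ((hasDerivAt_slice hsep (hball _ (update_mem_ball hr hvb a hζ)).2).sub
            (by simpa using (hasDerivAt_id ζ).const_mul (cpder F a z))).hasDerivWithinAt)
          (fun ζ hζ => by
            rw [← dist_eq_norm]; exact (hball _ (update_mem_ball hr hvb a hζ)).1.le)
          (Metric.mem_ball_self hr) hua
        rw [Finset.piecewise_insert, ← hv]
        have hv2 : F v = F (Function.update v a (z a)) := by
          rw [hv, ← piecewise_eq_update ha u z]
        rw [hv2]
        calc _ = ‖F (Function.update v a (u a)) - cpder F a z * u a -
              (F (Function.update v a (z a)) - cpder F a z * z a)‖ := by ring_nf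
          _ ≤ ε * ‖u a - z a‖ := hmv
          _ ≤ ε * ‖u - z‖ := by gcongr; exact norm_le_pi_norm (u - z) a
      refine (hsub.add ih).congr_left fun u => ?_
      rw [Finset.sum_insert ha]
      ring
  refine HasFDerivAt.of_isLittleO ?_
  have := key Finset.univ
  simp only [Finset.piecewise_univ] at this
  refine this.congr_left fun u => ?_
  simp

end Osgood

section DirectionalDerivative

variable {d : ℕ} {f : (Fin d → ℝ) → ℂ}

/-- Derivative of `f` in the direction `Y`. -/
noncomputable def dirDer (Y : Fin d → ℝ) (f : (Fin d → ℝ) → ℂ) : (Fin d → ℝ) → ℂ :=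
  fun x => fderiv ℝ f x Y

lemma contDiff_dirDer (Y : Fin d → ℝ) (hf : ContDiff ℝ (⊤ : ℕ∞) f) :
    ContDiff ℝ (⊤ : ℕ∞) (dirDer Y f) :=
  ((contDiff_infty_iff_fderiv.1 hf).2).clm_apply contDiff_const

lemma contDiff_iterate_dirDer (Y : Fin d → ℝ) (hf : ContDiff ℝ (⊤ : ℕ∞) f) (n : ℕ) :
    ContDiff ℝ (⊤ : ℕ∞) ((dirDer Y)^[n] f) := by
  induction n with
  | zero => exact hf
  | succ n ih => rw [Function.iterate_succ_apply']; exact contDiff_dirDer Y ih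

lemma dirDer_comm (Y Y' : Fin d → ℝ) (hf : ContDiff ℝ (⊤ : ℕ∞) f) :
    dirDer Y (dirDer Y' f) = dirDer Y' (dirDer Y f) := by
  have hd : Differentiable ℝ (fderiv ℝ f) :=
    (contDiff_infty_iff_fderiv.1 hf).2.differentiable (by simp)
  have key : ∀ (A B : Fin d → ℝ) (x : Fin d → ℝ),
      dirDer A (dirDer B f) x = fderiv ℝ (fderiv ℝ f) x A B := by
    intro A B x
    unfold dirDer
    rw [fderiv_clm_apply (hd x) (differentiableAt_const _)]
    simp
  funext x
  rw [key, key]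
  exact (hf.contDiffAt.isSymmSndFDerivAt (by simp; exact WithTop.coe_le_coe.2 le_top)) Y Y'

lemma dirDer_iterate_comm (Y Y' : Fin d → ℝ) (hf : ContDiff ℝ (⊤ : ℕ∞) f) (n : ℕ) :
    dirDer Y ((dirDer Y')^[n] f) = (dirDer Y')^[n] (dirDer Y f) := by
  induction n with
  | zero => rfl
  | succ n ih =>
    rw [Function.iterate_succ_apply', Function.iterate_succ_apply',
      dirDer_comm _ _ (contDiff_iterate_dirDer Y' hf n), ih]

lemma contDiff_foldr_pder (α : Fin d → ℕ) (hf : ContDiff ℝ (⊤ : ℕ∞) f) (l : List (Fin d)) :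
    ContDiff ℝ (⊤ : ℕ∞) (l.foldr (fun i g => (pder i)^[α i] g) f) := by
  induction l with
  | nil => exact hf
  | cons a l ih => exact contDiff_iterate_dirDer _ ih _

lemma contDiff_mder (α : Fin d → ℕ) (hf : ContDiff ℝ (⊤ : ℕ∞) f) :
    ContDiff ℝ (⊤ : ℕ∞) (mder α f) := contDiff_foldr_pder α hf _

lemma foldr_pder_update_of_notMem (α : Fin d → ℕ) (i : Fin d) (n : ℕ) {l : List (Fin d)}
    (hi : i ∉ l) :
    l.foldr (fun j g => (pder j)^[Function.update α i n j] g) f =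
      l.foldr (fun j g => (pder j)^[α j] g) f := by
  induction l with
  | nil => rfl
  | cons a l ih =>
    simp only [List.mem_cons, not_or] at hi
    rw [List.foldr_cons, List.foldr_cons, ih hi.2, Function.update_of_ne (Ne.symm hi.1)]

lemma foldr_pder_update (α : Fin d → ℕ) (i : Fin d) (hf : ContDiff ℝ (⊤ : ℕ∞) f)
    {l : List (Fin d)} (hl : l.Nodup) (hi : i ∈ l) :
    l.foldr (fun j g => (pder j)^[Function.update α i (α i + 1) j] g) f =
      pder i (l.foldr (fun j g => (pder j)^[α j] g) f) := by
  induction l with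
  | nil => simp at hi
  | cons a l ih =>
    rw [List.nodup_cons] at hl
    rw [List.foldr_cons, List.foldr_cons]
    rcases eq_or_ne i a with rfl | hne
    · rw [foldr_pder_update_of_notMem α i _ hl.1, Function.update_self,
        Function.iterate_succ_apply']
    · have hil : i ∈ l := (List.mem_cons.1 hi).resolve_left hne
      rw [ih hl.2 hil, Function.update_of_ne hne.symm]
      exact (dirDer_iterate_comm _ _ (contDiff_foldr_pder α hf l) _).symm

lemma mder_update (α : Fin d → ℕ) (i : Fin d) (hf : ContDiff ℝ (⊤ : ℕ∞) f) :
    mder (Function.update α i (α i + 1)) f = pder i (mder α f) :=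
  foldr_pder_update α i hf (List.nodup_finRange d) (List.mem_finRange i)

lemma msize_update (α : Fin d → ℕ) (i : Fin d) :
    msize (Function.update α i (α i + 1)) = msize α + 1 := by
  unfold msize
  rw [Finset.sum_update_of_mem (Finset.mem_univ i),
    ← Finset.add_sum_erase _ α (Finset.mem_univ i), Finset.erase_eq]
  ring

lemma mder_zero : mder (0 : Fin d → ℕ) f = f := by
  unfold mder
  generalize List.finRange d = l
  induction l with
  | nil => rfl
  | cons a l _ => simp

lemma iterate_dirDer_sum (Y : Fin d → ℝ) (c : Fin d → ℝ) {g : Fin d → (Fin d → ℝ) → ℂ}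
    (hg : ∀ i, ContDiff ℝ (⊤ : ℕ∞) (g i)) (n : ℕ) :
    (dirDer Y)^[n] (fun x => ∑ i, (c i : ℂ) * g i x) =
      fun x => ∑ i, (c i : ℂ) * (dirDer Y)^[n] (g i) x := by
  induction n with
  | zero => rfl
  | succ n ih =>
    rw [Function.iterate_succ_apply', ih]
    funext x
    have hdiff : ∀ i, DifferentiableAt ℝ ((dirDer Y)^[n] (g i)) x := fun i =>
      (contDiff_iterate_dirDer Y (hg i) n).differentiable (by simp) x
    unfold dirDer at hdiff ⊢
    rw [fderiv_fun_sum fun i _ => (hdiff i).const_mul _]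
    simp only [sum_apply]
    refine Finset.sum_congr rfl fun i _ => ?_
    rw [fderiv_const_mul (hdiff i), Function.iterate_succ_apply']
    rfl

lemma dirDer_eq_sum (Y : Fin d → ℝ) (x : Fin d → ℝ) :
    dirDer Y f x = ∑ i, (Y i : ℂ) * pder i f x := by
  unfold dirDer pder
  conv_lhs => rw [pi_eq_sum_univ' Y]
  simp [map_sum]

/-- Bounds on all partial derivatives yield bounds on iterated directional derivatives. -/
lemma norm_iterate_dirDer_le (Y : Fin d → ℝ) (hf : ContDiff ℝ (⊤ : ℕ∞) f) {x : Fin d → ℝ}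
    {M : ℕ → ℝ} (hM : ∀ α : Fin d → ℕ, ‖mder α f x‖ ≤ M (msize α)) (n : ℕ) :
    ‖(dirDer Y)^[n] f x‖ ≤ (∑ i, |Y i|) ^ n * M n := by
  have key : ∀ (n : ℕ) (α : Fin d → ℕ),
      ‖(dirDer Y)^[n] (mder α f) x‖ ≤ (∑ i, |Y i|) ^ n * M (msize α + n) := by
    intro n
    induction n with
    | zero => intro α; simpa using hM α
    | succ n ih =>
      intro α
      have h : dirDer Y (mder α f) =
          fun x => ∑ i, (Y i : ℂ) * mder (Function.update α i (α i + 1)) f x := by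
        funext x
        rw [dirDer_eq_sum]
        exact Finset.sum_congr rfl fun i _ => by rw [mder_update α i hf]
      rw [Function.iterate_succ_apply, h,
        iterate_dirDer_sum Y Y (fun i => contDiff_mder _ hf), pow_succ', Finset.sum_mul,
        Finset.sum_mul]
      refine norm_sum_le_of_le _ fun i _ => ?_
      have := ih (Function.update α i (α i + 1))
      rw [msize_update, add_assoc, add_comm 1 n] at this
      rw [norm_mul, Complex.norm_real, Real.norm_eq_abs, mul_assoc]
      gcongr
  have := key n 0
  rwa [mder_zero, show msize (0 : Fin d → ℕ) = 0 by simp [msize], zero_add] at this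

lemma support_dirDer_subset {K : Set (Fin d → ℝ)} (hK : IsClosed K) (Y : Fin d → ℝ)
    (hf : Function.support f ⊆ K) : Function.support (dirDer Y f) ⊆ K := by
  refine Function.support_subset_iff'.2 fun x hx => ?_
  have : f =ᶠ[𝓝 x] fun _ => 0 := by
    filter_upwards [hK.isOpen_compl.mem_nhds hx] with y hy
    exact Function.support_subset_iff'.1 hf y hy
  rw [dirDer, this.fderiv_eq]
  simp

lemma support_iterate_dirDer_subset {K : Set (Fin d → ℝ)} (hK : IsClosed K) (Y : Fin d → ℝ)
    (hf : Function.support f ⊆ K) (n : ℕ) : Function.support ((dirDer Y)^[n] f) ⊆ K := by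
  induction n with
  | zero => exact hf
  | succ n ih => rw [Function.iterate_succ_apply']; exact support_dirDer_subset hK Y ih

/-- The character `x ↦ exp (-i x·ξ)`. -/
noncomputable def planeWave (ξ x : Fin d → ℝ) : ℂ :=
  Complex.exp (-Complex.I * (∑ i, (x i : ℂ) * (ξ i : ℂ)))

lemma norm_planeWave (ξ x : Fin d → ℝ) : ‖planeWave ξ x‖ = 1 := by
  rw [planeWave, Complex.norm_exp]
  have : (∑ i, (x i : ℂ) * (ξ i : ℂ)) = ((∑ i, x i * ξ i : ℝ) : ℂ) := by push_cast; rfl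
  rw [this]
  simp

lemma contDiff_planeWave (ξ : Fin d → ℝ) : ContDiff ℝ (⊤ : ℕ∞) (planeWave ξ) := by
  unfold planeWave
  refine ContDiff.cexp (contDiff_const.mul (ContDiff.sum fun i _ => ContDiff.mul ?_ contDiff_const))
  exact Complex.ofRealCLM.contDiff.comp (contDiff_apply ℝ ℝ i)

lemma dirDer_mul_planeWave (Y ξ : Fin d → ℝ) (hf : ContDiff ℝ (⊤ : ℕ∞) f) (x : Fin d → ℝ) :
    dirDer Y (fun x => f x * planeWave ξ x) x =
      dirDer Y f x * planeWave ξ x -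
        Complex.I * ((∑ i, Y i * ξ i : ℝ) : ℂ) * (f x * planeWave ξ x) := by
  have hw : HasFDerivAt (planeWave ξ)
      (planeWave ξ x • (-Complex.I • (∑ i, (ξ i : ℂ) • Complex.ofRealCLM.comp
        (ContinuousLinearMap.proj (R := ℝ) (φ := fun _ => ℝ) i)))) x := by
    refine HasFDerivAt.cexp (HasFDerivAt.const_mul (HasFDerivAt.fun_sum fun i _ => ?_) _)
    refine HasFDerivAt.mul_const ?_ _
    exact (Complex.ofRealCLM.comp
      (ContinuousLinearMap.proj (R := ℝ) (φ := fun _ => ℝ) i)).hasFDerivAt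
  have hf' := (hf.differentiable (by simp) x).hasFDerivAt
  unfold dirDer
  rw [(hf'.fun_mul hw).fderiv]
  simp
  simp_rw [mul_comm (ξ _ : ℂ) (Y _ : ℂ)]
  ring

end DirectionalDerivative

section Transport

open MeasureTheory Set

variable {d : ℕ} {f g : (Fin d → ℝ) → ℝ → ℂ} {K : Set (Fin d → ℝ)} {a b : ℝ}

/-- If `f` solves the transport equation `∂ₛ f = i Y·∇ₓ f` near `K`, then pairing with a test
function supported in `K` moves the derivative onto the test function. -/
lemma hasDerivAt_integral_of_transport (hK : IsCompact K) (Y : Fin d → ℝ)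
    (hf : ContinuousOn (fun p : (Fin d → ℝ) × ℝ => f p.1 p.2) (K ×ˢ Ioo a b))
    (hg : ContinuousOn (fun p : (Fin d → ℝ) × ℝ => g p.1 p.2) (K ×ˢ Ioo a b))
    (hfx : ∀ x ∈ K, ∀ s ∈ Ioo a b, HasLineDerivAt ℝ (fun x => f x s) (g x s) x Y)
    (hfs : ∀ x ∈ K, ∀ s ∈ Ioo a b, HasDerivAt (fun s => f x s) (Complex.I * g x s) s)
    {ψ : (Fin d → ℝ) → ℂ} (hψ : ContDiff ℝ (⊤ : ℕ∞) ψ) (hψK : Function.support ψ ⊆ K)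
    {s : ℝ} (hs : s ∈ Ioo a b) :
    HasDerivAt (fun s => ∫ x in K, f x s * ψ x)
      (-Complex.I * ∫ x in K, f x s * dirDer Y ψ x) s := by
  have hmaps : ∀ s ∈ Ioo a b, MapsTo (fun x : Fin d → ℝ => (x, s)) K (K ×ˢ Ioo a b) :=
    fun s hs x hx => ⟨hx, hs⟩
  have hfc : ∀ s ∈ Ioo a b, ContinuousOn (fun x => f x s) K := fun s hs =>
    hf.comp (by fun_prop) (hmaps s hs)
  have hgc : ∀ s ∈ Ioo a b, ContinuousOn (fun x => g x s) K := fun s hs =>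
    hg.comp (by fun_prop) (hmaps s hs)
  have hψc : Continuous ψ := hψ.continuous
  have hdc : Continuous (dirDer Y ψ) := (contDiff_dirDer Y hψ).continuous
  obtain ⟨u, hus, v, hsv⟩ : ∃ u, (a < u ∧ u < s) ∧ ∃ v, s < v ∧ v < b :=
    ⟨(a + s) / 2, ⟨by linarith [hs.1], by linarith [hs.1]⟩, (s + b) / 2, by linarith [hs.2],
      by linarith [hs.2]⟩
  have hsub : Icc u v ⊆ Ioo a b := fun t ht => ⟨hus.1.trans_le ht.1, ht.2.trans_lt hsv.2⟩
  obtain ⟨M, hM⟩ := (hK.prod (isCompact_Icc (a := u) (b := v))).exists_bound_of_continuousOn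
    (f := fun p : (Fin d → ℝ) × ℝ => Complex.I * g p.1 p.2 * ψ p.1)
    ((continuousOn_const.mul (hg.mono (prod_mono_right hsub))).mul (by fun_prop))
  have hmeas := hK.measurableSet
  have h1 := (hasDerivAt_integral_of_dominated_loc_of_deriv_le (μ := volume.restrict K)
    (F := fun s x => f x s * ψ x) (F' := fun s x => Complex.I * g x s * ψ x) (x₀ := s)
    (s := Icc u v) (bound := fun _ => M) (Icc_mem_nhds hus.2 hsv.1)
    (by
      filter_upwards [Ioo_mem_nhds hs.1 hs.2] with t ht
      exact ((hfc t ht).mul hψc.continuousOn).aestronglyMeasurable hmeas)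
    (((hfc s hs).mul hψc.continuousOn).integrableOn_compact hK)
    (((continuousOn_const.mul (hgc s hs)).mul hψc.continuousOn).aestronglyMeasurable hmeas)
    ((ae_restrict_iff' hmeas).2 <| ae_of_all _ fun x hx t ht => hM (x, t) ⟨hx, ht⟩)
    (integrableOn_const hK.measure_lt_top.ne)
    ((ae_restrict_iff' hmeas).2 <| ae_of_all _ fun x hx t ht =>
      (hfs x hx t (hsub ht)).mul_const _)).2
  refine h1.congr_deriv ?_
  have hdK := support_dirDer_subset hK.isClosed Y hψK
  have hts : tsupport ψ ⊆ K := closure_minimal hψK hK.isClosed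
  have hint : ∀ {p q : (Fin d → ℝ) → ℂ}, ContinuousOn p K → Continuous q →
      Function.support q ⊆ K → Integrable (fun x => p x * q x) := by
    intro p q hp hq hqK
    refine (integrableOn_iff_integrable_of_support_subset (s := K) ?_).1
      ((hp.mul hq.continuousOn).integrableOn_compact hK)
    exact (Function.support_mul_subset_right _ _).trans hqK
  have hset : ∀ {p q : (Fin d → ℝ) → ℂ}, Function.support q ⊆ K →
      ∫ x in K, p x * q x = ∫ x, p x * q x := by
    intro p q hqK
    refine setIntegral_eq_integral_of_forall_compl_eq_zero fun x hx => ?_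
    rw [Function.support_subset_iff'.1 hqK x hx, mul_zero]
  have hibp := integral_bilinear_hasLineDerivAt_right_eq_neg_left_of_integrable
    (μ := (volume : Measure (Fin d → ℝ))) (v := Y) (B := ContinuousLinearMap.mul ℝ ℂ)
    (f := fun x => f x s) (f' := fun x => g x s) (g := ψ) (g' := dirDer Y ψ)
    (hint (hgc s hs) hψc hψK) (hint (hfc s hs) hdc hdK) (hint (hfc s hs) hψc hψK)
    (fun x hx => hfx x (hts hx) s hs)
    (fun x _ => (hψ.differentiable (by simp) x).hasFDerivAt.hasLineDerivAt Y)
  simp only [ContinuousLinearMap.mul_apply'] at hibp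
  rw [hset hdK, hibp]
  simp only [mul_assoc]
  rw [integral_const_mul, hset hψK]
  ring

/-- The point `x + i s Y` of `ℂ^d`. -/
noncomputable def cshift (Y x : Fin d → ℝ) (s : ℝ) : Fin d → ℂ :=
  fun i => (x i : ℂ) + (s * Y i : ℝ) * Complex.I

lemma continuous_cshift (Y : Fin d → ℝ) :
    Continuous fun p : (Fin d → ℝ) × ℝ => cshift Y p.1 p.2 := by
  unfold cshift
  fun_prop

lemma re_cshift (Y x : Fin d → ℝ) (s : ℝ) : (fun i => (cshift Y x s i).re) = x := by
  funext i; simp [cshift]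

lemma im_cshift (Y x : Fin d → ℝ) (s : ℝ) : (fun i => (cshift Y x s i).im) = s • Y := by
  funext i; simp [cshift]

/-- Derivatives along `s ↦ x + i s Y` of a complex differentiable function, paired with a test
function. -/
lemma hasDerivAt_integral_cshift {F : (Fin d → ℂ) → ℂ} {Z : Set (Fin d → ℂ)} (hZ : IsOpen Z)
    (hsep : ∀ z ∈ Z, ∀ j, AnalyticAt ℂ (fun w : ℂ => F (Function.update z j w)) (z j))
    (hbdd : ∀ z ∈ Z, ∃ M, ∀ᶠ w in 𝓝 z, ‖F w‖ ≤ M) (hK : IsCompact K) (Y : Fin d → ℝ)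
    (hKZ : ∀ x ∈ K, ∀ s ∈ Ioo a b, cshift Y x s ∈ Z)
    {ψ : (Fin d → ℝ) → ℂ} (hψ : ContDiff ℝ (⊤ : ℕ∞) ψ) (hψK : Function.support ψ ⊆ K)
    {s : ℝ} (hs : s ∈ Ioo a b) :
    HasDerivAt (fun s => ∫ x in K, F (cshift Y x s) * ψ x)
      (-Complex.I * ∫ x in K, F (cshift Y x s) * dirDer Y ψ x) s := by
  have hcont : ContinuousOn F Z := fun w hw =>
    (continuousAt_of_separately_analytic hZ hsep hbdd hw).continuousWithinAt
  have hmaps : MapsTo (fun p : (Fin d → ℝ) × ℝ => cshift Y p.1 p.2) (K ×ˢ Ioo a b) Z :=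
    fun p hp => hKZ _ hp.1 _ hp.2
  have hder := fun z hz => hasFDerivAt_of_separately_analytic (z := z) hZ hsep hbdd hz
  have hgc : ContinuousOn (fun z => ∑ j, (Y j : ℂ) * cpder F j z) Z :=
    continuousOn_finsetSum _ fun j _ => continuousOn_const.mul fun w hw =>
      (continuousAt_cpder hZ hsep hcont j hw).continuousWithinAt
  refine hasDerivAt_integral_of_transport (g := fun x s => ∑ j, (Y j : ℂ) * cpder F j (cshift Y x s))
    hK Y (hcont.comp (continuous_cshift Y).continuousOn hmaps)
    (hgc.comp (continuous_cshift Y).continuousOn hmaps) ?_ ?_ hψ hψK hs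
  · intro x hx t ht
    have h1 : HasDerivAt (fun r : ℝ => cshift Y (x + r • Y) t) (fun i => (Y i : ℂ)) 0 := by
      refine hasDerivAt_pi.2 fun i => ?_
      have := ((hasDerivAt_id (0 : ℝ)).mul_const (Y i)).const_add (x i)
      simpa [cshift] using this.ofReal_comp.add_const ((t * Y i : ℝ) * Complex.I)
    have h2 := hder _ (hKZ x hx t ht)
    have h3 : HasDerivAt (fun r : ℝ => F (cshift Y (x + r • Y) t)) _ 0 :=
      (h2.restrictScalars ℝ).comp_hasDerivAt_of_eq (0 : ℝ) h1 (by simp)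
    refine HasDerivAt.congr_deriv h3 ?_
    simp [mul_comm]
  · intro x hx t ht
    have h1 : HasDerivAt (fun r : ℝ => cshift Y x r) (fun i => (Y i : ℂ) * Complex.I) t := by
      refine hasDerivAt_pi.2 fun i => ?_
      have := (hasDerivAt_id t).mul_const (Y i)
      simpa [cshift] using (this.ofReal_comp.mul_const Complex.I).const_add (x i : ℂ)
    have h2 := hder _ (hKZ x hx t ht)
    have h3 : HasDerivAt (fun r : ℝ => F (cshift Y x r)) _ t :=
      (h2.restrictScalars ℝ).comp_hasDerivAt t h1
    refine h3.congr_deriv ?_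
    simp only [ContinuousLinearMap.coe_restrictScalars', sum_apply,
      smul_apply, ContinuousLinearMap.proj_apply, smul_eq_mul, Finset.mul_sum]
    exact Finset.sum_congr rfl fun i _ => by ring

end Transport

section BoundaryLimit

open Set Filter

variable {J : ℕ → ℝ → ℂ} {S : ℕ → ℝ}

/-- Taylor polynomial at `s` of order `n`, evaluated at `t`, of `J 0` when `(J k)' = -i J (k+1)`. -/
noncomputable def chainTaylor (J : ℕ → ℝ → ℂ) (n : ℕ) (t s : ℝ) : ℂ :=
  ∑ k ∈ Finset.range (n + 1), (Complex.I * (s - t : ℝ)) ^ k / k.factorial * J k s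

lemma chainTaylor_succ (n : ℕ) (t s : ℝ) : chainTaylor J (n + 1) t s = chainTaylor J n t s +
    (Complex.I * (s - t : ℝ)) ^ (n + 1) / (n + 1).factorial * J (n + 1) s :=
  Finset.sum_range_succ _ _

lemma chainTaylor_self (n : ℕ) (t : ℝ) : chainTaylor J n t t = J 0 t := by
  unfold chainTaylor
  rw [Finset.sum_range_succ']
  simp

lemma hasDerivAt_chainTaylor {s : ℝ}
    (hJ : ∀ k, HasDerivAt (J k) (-Complex.I * J (k + 1) s) s) (n : ℕ) (t : ℝ) :
    HasDerivAt (chainTaylor J n t)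
      (-Complex.I * ((Complex.I * (s - t : ℝ)) ^ n / n.factorial * J (n + 1) s)) s := by
  induction n with
  | zero =>
    have h0 : chainTaylor J 0 t = J 0 := by funext r; simp [chainTaylor]
    simpa [h0] using hJ 0
  | succ n ih =>
    have hlin : HasDerivAt (fun r : ℝ => Complex.I * ((r - t : ℝ) : ℂ)) Complex.I s := by
      simpa using (((hasDerivAt_id s).sub_const t).ofReal_comp).const_mul Complex.I
    have h := ih.add (((hlin.pow (n + 1)).div_const ((n + 1).factorial : ℂ)).mul (hJ (n + 1)))
    have hfun : chainTaylor J (n + 1) t = fun s => chainTaylor J n t s +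
        (Complex.I * (s - t : ℝ)) ^ (n + 1) / (n + 1).factorial * J (n + 1) s :=
      funext fun s => chainTaylor_succ n t s
    rw [hfun]
    refine h.congr_deriv ?_
    have hn : (n.factorial : ℂ) ≠ 0 := by exact_mod_cast n.factorial_ne_zero
    have hn1 : (n : ℂ) + 1 ≠ 0 := by exact_mod_cast n.succ_ne_zero
    rw [Nat.factorial_succ]
    push_cast
    simp only [Pi.pow_apply]
    field_simp
    ring

lemma norm_chainTaylor_coeff_le {s t : ℝ} (ht : 0 ≤ t) (hts : t ≤ s) (n : ℕ) (w : ℂ) :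
    ‖(Complex.I * (s - t : ℝ)) ^ n / n.factorial * w‖ ≤ ‖w‖ * s ^ n := by
  rw [norm_mul, norm_div, norm_pow, norm_mul, Complex.norm_I, one_mul, Complex.norm_real,
    Real.norm_of_nonneg (sub_nonneg.2 hts), Complex.norm_natCast, mul_comm]
  have h1 : (1 : ℝ) ≤ n.factorial := by exact_mod_cast n.factorial_pos
  refine mul_le_mul_of_nonneg_left ?_ (norm_nonneg _)
  exact (div_le_self (pow_nonneg (sub_nonneg.2 hts) n) h1).trans
    (pow_le_pow_left₀ (sub_nonneg.2 hts) (by linarith) n)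

/-- Boundary limit of `J 0` for a chain `(J k)' = -i J (k+1)`, from weighted bounds of `J (n+1)`
on consecutive intervals `[S (n+1), S n]` shrinking to `0`. -/
lemma exists_tendsto_of_chain (hSanti : Antitone S) (hSpos : ∀ n, 0 < S n)
    (hS0 : S 0 < 1) (hSlim : Tendsto S atTop (𝓝 0))
    (hJ : ∀ k, ∀ s ∈ Ioo (0 : ℝ) 1, HasDerivAt (J k) (-Complex.I * J (k + 1) s) s) {Q : ℝ}
    (hQ0 : ‖J 0 (S 0)‖ ≤ Q)
    (hQ : ∀ n, ∀ s ∈ Icc (S (n + 1)) (S n), ‖J (n + 1) s‖ * s ^ n ≤ Q * (1 / 2) ^ n) :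
    ∃ u, Tendsto (J 0) (𝓝[>] 0) (𝓝 u) ∧ ‖u‖ ≤ 5 * Q := by
  set a : ℕ → ℝ → ℂ := fun n t => chainTaylor J n t (max t (S n)) with ha
  have hS1 : ∀ n, S n < 1 := fun n => (hSanti n.zero_le).trans_lt hS0
  have hdiff : ∀ n, ∀ t, 0 ≤ t → ‖a (n + 1) t - a n t‖ ≤ 2 * Q * (1 / 2) ^ n := by
    intro n t ht
    have hSn := hSanti n.le_succ
    have hQn : 0 ≤ Q * (1 / 2) ^ n :=
      le_trans (mul_nonneg (norm_nonneg _) (pow_nonneg (hSpos n).le n)) (hQ n (S n) ⟨hSn, le_rfl⟩)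
    rcases le_or_gt (S n) t with h | h
    · simp only [ha, max_eq_left h, max_eq_left (hSn.trans h), chainTaylor_self, sub_self, norm_zero]
      linarith
    · set s := max t (S (n + 1)) with hs
      have hsn : s ≤ S n := max_le h.le hSn
      have hsmem : s ∈ Icc (S (n + 1)) (S n) := ⟨le_max_right _ _, hsn⟩
      have hs0 : 0 ≤ s := ht.trans (le_max_left _ _)
      have h1 : ‖chainTaylor J n t s - chainTaylor J n t (S n)‖ ≤ Q * (1 / 2) ^ n := by
        have hmv := (convex_Icc s (S n)).norm_image_sub_le_of_norm_hasDerivWithin_le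
          (f := chainTaylor J n t) (C := Q * (1 / 2) ^ n)
          (fun r hr => (hasDerivAt_chainTaylor (fun k => hJ k r
            ⟨(hSpos (n + 1)).trans_le (hsmem.1.trans hr.1), hr.2.trans_lt (hS1 n)⟩)
              n t).hasDerivWithinAt)
          (fun r hr => by
            rw [norm_mul, norm_neg, Complex.norm_I, one_mul]
            exact (norm_chainTaylor_coeff_le ht ((le_max_left _ _).trans hr.1) n _).trans
              (hQ n r ⟨hsmem.1.trans hr.1, hr.2⟩))
          (right_mem_Icc.2 hsn) (left_mem_Icc.2 hsn)
        refine hmv.trans (mul_le_of_le_one_right hQn ?_)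
        rw [Real.norm_eq_abs, abs_le]
        constructor <;> linarith [hS1 n]
      have h2 : ‖(Complex.I * (s - t : ℝ)) ^ (n + 1) / (n + 1).factorial * J (n + 1) s‖ ≤
          Q * (1 / 2) ^ n := by
        refine (norm_chainTaylor_coeff_le ht (le_max_left _ _) (n + 1) _).trans
          (le_trans ?_ (hQ n s hsmem))
        gcongr ?_ * ?_
        exact pow_le_pow_of_le_one hs0 (hsn.trans (hS1 n).le) n.le_succ
      have hsplit : a (n + 1) t - a n t = (chainTaylor J n t s - chainTaylor J n t (S n)) +
          (Complex.I * (s - t : ℝ)) ^ (n + 1) / (n + 1).factorial * J (n + 1) s := by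
        simp only [ha, max_eq_right h.le, ← hs, chainTaylor_succ]
        ring
      rw [hsplit]
      exact (norm_add_le _ _).trans (by linarith)
  have hgeom : HasSum (fun n : ℕ => 2 * Q * (1 / 2) ^ n) (4 * Q) := by
    have := hasSum_geometric_two.mul_left (2 * Q)
    rwa [show 2 * Q * 2 = 4 * Q by ring] at this
  have hlim : ∀ n, Tendsto (a n) (𝓝[>] 0) (𝓝 (a n 0)) := by
    intro n
    have hcont : Continuous fun t => chainTaylor J n t (S n) := by
      unfold chainTaylor
      fun_prop
    have h0 : a n 0 = chainTaylor J n 0 (S n) := by simp [ha, max_eq_right (hSpos n).le]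
    rw [h0]
    refine ((hcont.tendsto 0).mono_left nhdsWithin_le_nhds).congr' ?_
    filter_upwards [nhdsWithin_le_nhds (Iio_mem_nhds (hSpos n))] with t ht
    simp only [ha, max_eq_right (mem_Iio.1 ht).le]
  have htel : ∀ t, 0 < t → J 0 t = a 0 t + ∑' n, (a (n + 1) t - a n t) := by
    intro t ht
    have hsum : Summable fun n => ‖a (n + 1) t - a n t‖ :=
      Summable.of_nonneg_of_le (fun _ => norm_nonneg _) (fun n => hdiff n t ht.le) hgeom.summable
    have hs : HasSum (fun n => a (n + 1) t - a n t) (J 0 t - a 0 t) := by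
      rw [hasSum_iff_tendsto_nat_of_summable_norm hsum]
      simp_rw [Finset.sum_range_sub (fun n => a n t)]
      refine tendsto_const_nhds.congr' ?_
      filter_upwards [hSlim.eventually (Iio_mem_nhds ht)] with n hn
      simp [ha, max_eq_left (le_of_lt hn), chainTaylor_self]
    rw [hs.tsum_eq]
    ring
  refine ⟨a 0 0 + ∑' n, (a (n + 1) 0 - a n 0), ?_, ?_⟩
  · have htsum : Tendsto (fun t => ∑' n, (a (n + 1) t - a n t)) (𝓝[>] 0)
        (𝓝 (∑' n, (a (n + 1) 0 - a n 0))) := by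
      refine tendsto_tsum_of_dominated_convergence hgeom.summable
        (fun n => (hlim (n + 1)).sub (hlim n)) ?_
      filter_upwards [self_mem_nhdsWithin] with t ht n
      exact hdiff n t (le_of_lt ht)
    refine ((hlim 0).add htsum).congr' ?_
    filter_upwards [self_mem_nhdsWithin] with t ht
    exact (htel t ht).symm
  · have h0 : a 0 0 = J 0 (S 0) := by
      simp [ha, max_eq_right (hSpos 0).le, chainTaylor]
    have h1 : ‖∑' n, (a (n + 1) 0 - a n 0)‖ ≤ 4 * Q :=
      tsum_of_norm_bounded hgeom fun n => hdiff n 0 le_rfl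
    refine (norm_add_le _ _).trans ?_
    rw [h0]
    linarith

end BoundaryLimit

section Bounds

variable {d : ℕ}

lemma continuous_vnorm : Continuous (vnorm : (Fin d → ℝ) → ℝ) := by
  unfold vnorm
  fun_prop

lemma vnorm_smul {s : ℝ} (hs : 0 ≤ s) (y : Fin d → ℝ) : vnorm (s • y) = s * vnorm y := by
  simp only [vnorm, Pi.smul_apply, smul_eq_mul, mul_pow, ← Finset.mul_sum]
  rw [Real.sqrt_mul (sq_nonneg s), Real.sqrt_sq hs]

lemma vnorm_pos {y : Fin d → ℝ} (hy : y ≠ 0) : 0 < vnorm y := by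
  obtain ⟨i, hi⟩ := Function.ne_iff.1 hy
  refine Real.sqrt_pos.2 (Finset.sum_pos' (fun _ _ => sq_nonneg _) ⟨i, Finset.mem_univ i, ?_⟩)
  exact sq_pos_iff.2 hi

/-- The associated function `T (1/s)` is bounded for `s` away from `0`. -/
lemma exists_exp_assocT_le {σ τ H δ : ℝ} (hσ : 1 < σ) (hτ : 0 < τ) (hH : 0 < H) (hδ : 0 < δ) :
    ∃ M : ℝ, ∀ s, δ ≤ s → Real.exp (AssocT (((2 : ℝ) ^ σ - 1) * τ) σ H (1 / s)) ≤ M := by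
  obtain ⟨B, -, hB⟩ := exists_exp_assocT_mul_le (β := 1) hσ hτ hH one_pos one_pos one_pos
  have hb : 0 < τ / (4 : ℝ) ^ (σ - 1) := by positivity
  obtain ⟨n, hn⟩ := ((tendsto_weightNode one_pos hb hσ).eventually (Iio_mem_nhds hδ)).exists
  set s₁ := weightNode 1 (τ / (4 : ℝ) ^ (σ - 1)) σ n
  have hs₁ : 0 < s₁ := weightNode_pos one_pos n
  set X := gevreyWeight 1 (τ / (4 : ℝ) ^ (σ - 1)) σ (n + 1) * s₁ ^ n
  have hX : 0 < X := mul_pos (gevreyWeight_pos one_pos _) (pow_pos hs₁ n)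
  refine ⟨B / X, fun s hs => ?_⟩
  have h := hB s (hδ.trans_le hs) X hX.le (fun r => by
    refine (gevreyWeight_mul_pow_le_succ one_pos hb hσ
      (weightNode_antitone one_pos hb hσ n.le_succ) le_rfl r).trans ?_
    refine mul_le_mul_of_nonneg_left ?_ (gevreyWeight_pos one_pos _).le
    exact pow_le_pow_left₀ hs₁.le ((le_of_lt hn).trans hs) r) 0
  rw [le_div_iff₀ hX]
  simpa [powLog, Real.zero_rpow (show σ ≠ 0 by linarith)] using h

lemma exists_norm_mder_le {τ σ : ℝ} (hσ : 1 < σ) {K : Set (Fin d → ℝ)} {φ : (Fin d → ℝ) → ℂ}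
    (h : GNorm τ σ 1 K φ < ⊤) : ∃ C : ℝ, 0 ≤ C ∧ ∀ α : Fin d → ℕ, ∀ x ∈ K,
      ‖mder α φ x‖ ≤ C * Real.exp (τ * powLog σ (msize α)) := by
  refine ⟨(GNorm τ σ 1 K φ).toReal, ENNReal.toReal_nonneg, fun α x hx => ?_⟩
  have h1 : ENNReal.ofReal (‖mder α φ x‖ /
      ((1 : ℝ) ^ ((msize α : ℝ) ^ σ) * (msize α : ℝ) ^ (τ * (msize α : ℝ) ^ σ))) ≤
      GNorm τ σ 1 K φ := by
    unfold GNorm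
    exact le_iSup_of_le α (le_iSup₂_of_le x hx le_rfl)
  rw [ENNReal.ofReal_le_iff_le_toReal h.ne, Real.one_rpow, one_mul, natCast_rpow_mul_rpow hσ,
    div_le_iff₀ (Real.exp_pos _)] at h1
  exact h1

lemma exp_neg_le_factorial_div_pow {x : ℝ} (hx : 0 < x) (p : ℕ) :
    Real.exp (-x) ≤ p.factorial / x ^ p := by
  have hp : (0 : ℝ) < p.factorial := by exact_mod_cast p.factorial_pos
  rw [Real.exp_neg, inv_le_comm₀ (Real.exp_pos _) (by positivity), inv_div]
  exact Real.pow_div_factorial_le_exp x hx.le p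

end Bounds

section Pairing

open MeasureTheory Set

variable {d : ℕ} {K : Set (Fin d → ℝ)} {F : (Fin d → ℂ) → ℂ}

/-- The integral of `F (x + i s Y)` against `(Y·∇)^k φ` times a character, normalized by
`exp (s Y·ξ)`. -/
noncomputable def charPairing (F : (Fin d → ℂ) → ℂ) (K : Set (Fin d → ℝ))
    (φ : (Fin d → ℝ) → ℂ) (Y ξ : Fin d → ℝ) (k : ℕ) (s : ℝ) : ℂ :=
  Complex.exp ((s * ∑ i, Y i * ξ i : ℝ)) *
    ∫ x in K, F (cshift Y x s) * ((dirDer Y)^[k] φ x * planeWave ξ x)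

lemma hasDerivAt_charPairing {Z : Set (Fin d → ℂ)} (hZ : IsOpen Z)
    (hsep : ∀ z ∈ Z, ∀ j, AnalyticAt ℂ (fun w : ℂ => F (Function.update z j w)) (z j))
    (hbdd : ∀ z ∈ Z, ∃ M, ∀ᶠ w in 𝓝 z, ‖F w‖ ≤ M) (hK : IsCompact K) (Y ξ : Fin d → ℝ)
    {a b : ℝ} (hKZ : ∀ x ∈ K, ∀ s ∈ Ioo a b, cshift Y x s ∈ Z)
    {φ : (Fin d → ℝ) → ℂ} (hφ : ContDiff ℝ (⊤ : ℕ∞) φ) (hφK : Function.support φ ⊆ K)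
    (k : ℕ) {s : ℝ} (hs : s ∈ Ioo a b) :
    HasDerivAt (charPairing F K φ Y ξ k) (-Complex.I * charPairing F K φ Y ξ (k + 1) s) s := by
  have hk := contDiff_iterate_dirDer Y hφ
  have hw := contDiff_planeWave ξ
  have hFc : ContinuousOn (fun x => F (cshift Y x s)) K := by
    have hcont : ContinuousOn F Z := fun w hw =>
      (continuousAt_of_separately_analytic hZ hsep hbdd hw).continuousWithinAt
    exact hcont.comp ((continuous_cshift Y).comp
      (Continuous.prodMk_left s)).continuousOn fun x hx => hKZ x hx s hs
  have hint : ∀ k, Integrable (fun x => F (cshift Y x s) *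
      ((dirDer Y)^[k] φ x * planeWave ξ x)) (volume.restrict K) := fun k =>
    (hFc.mul ((hk k).continuous.mul hw.continuous).continuousOn).integrableOn_compact hK
  have h1 := hasDerivAt_integral_cshift hZ hsep hbdd hK Y hKZ ((hk k).mul hw)
    ((Function.support_mul_subset_left _ _).trans
      (support_iterate_dirDer_subset hK.isClosed Y hφK k)) hs
  set l : ℝ := ∑ i, Y i * ξ i with hl
  have h2 : HasDerivAt (fun s : ℝ => Complex.exp ((s * l : ℝ)))
      (Complex.exp ((s * l : ℝ)) * l) s := by
    have := ((hasDerivAt_id s).mul_const l).ofReal_comp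
    simpa using this.cexp
  refine (h2.mul h1).congr_deriv ?_
  have h3 : ∫ x in K, F (cshift Y x s) *
        dirDer Y (fun x => (dirDer Y)^[k] φ x * planeWave ξ x) x =
      (∫ x in K, F (cshift Y x s) * ((dirDer Y)^[k + 1] φ x * planeWave ξ x)) -
        Complex.I * l * ∫ x in K, F (cshift Y x s) * ((dirDer Y)^[k] φ x * planeWave ξ x) := by
    rw [← integral_const_mul, ← integral_sub (hint (k + 1)) ((hint k).const_mul _)]
    refine integral_congr_ae (Filter.Eventually.of_forall fun x => ?_)
    simp only
    rw [dirDer_mul_planeWave Y ξ (hk k), Function.iterate_succ_apply', ← hl]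
    ring
  unfold charPairing
  rw [← hl, h3]
  linear_combination (Complex.exp ((s * l : ℝ)) * l *
    ∫ x in K, F (cshift Y x s) * ((dirDer Y)^[k] φ x * planeWave ξ x)) * Complex.I_sq

lemma norm_charPairing_le {φ : (Fin d → ℝ) → ℂ} (hφ : ContDiff ℝ (⊤ : ℕ∞) φ)
    (hK : IsCompact K) {Y : Fin d → ℝ} (ξ : Fin d → ℝ) {s C₁ : ℝ}
    (hF : ∀ x ∈ K, ‖F (cshift Y x s)‖ ≤ C₁) {M : ℕ → ℝ} (hM0 : ∀ n, 0 ≤ M n)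
    (hM : ∀ α : Fin d → ℕ, ∀ x ∈ K, ‖mder α φ x‖ ≤ M (msize α)) {b : ℝ}
    (hb : ∑ i, |Y i| ≤ b) (k : ℕ) :
    ‖charPairing F K φ Y ξ k s‖ ≤
      Real.exp (s * ∑ i, Y i * ξ i) * (C₁ * (b ^ k * M k) * volume.real K) := by
  rw [charPairing, norm_mul, Complex.norm_exp, Complex.ofReal_re]
  refine mul_le_mul_of_nonneg_left ?_ (Real.exp_pos _).le
  refine norm_setIntegral_le_of_norm_le_const hK.measure_lt_top fun x hx => ?_
  rw [norm_mul, norm_mul, norm_planeWave, mul_one]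
  refine mul_le_mul (hF x hx) ?_ (norm_nonneg _) ((norm_nonneg _).trans (hF x hx))
  refine (norm_iterate_dirDer_le Y hφ (fun α => hM α x hx) k).trans ?_
  refine mul_le_mul_of_nonneg_right ?_ (hM0 k)
  exact pow_le_pow_left₀ (Finset.sum_nonneg fun i _ => abs_nonneg _) hb k

end Pairing

/-- on a cone `V` on which `Y·ξ ≤ −γ₁|ξ|`, the localized Fourier
transform of the boundary value `F(·+iΓ0)` decays like
`exp(−T_{(2^σ−1)τ,σ,c}(|ξ|))`. -/
theorem stmt13 (d : ℕ) (hd : 1 ≤ d) (σ τ γ : ℝ) (hσ : 1 < σ) (hτ : 0 < τ) (hγ : 0 < γ)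
    (U : Set (Fin d → ℝ)) (hU : IsOpen U)
    (Γ : Set (Fin d → ℝ)) (hΓopen : IsOpen Γ) (hΓ0 : (0 : Fin d → ℝ) ∉ Γ)
    (hΓcone : ∀ y ∈ Γ, ∀ t : ℝ, 0 < t → t • y ∈ Γ)
    (F : (Fin d → ℂ) → ℂ)
    (hFanal : ∀ z : Fin d → ℂ,
      (fun i => (z i).re) ∈ U → (fun i => (z i).im) ∈ Γ →
      vnorm (fun i => (z i).im) < γ →
      ∀ j : Fin d, AnalyticAt ℂ (fun w : ℂ => F (Function.update z j w)) (z j))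
    (A H : ℝ) (hA : 0 < A) (hH : 0 < H)
    (hFbound : ∀ z : Fin d → ℂ,
      (fun i => (z i).re) ∈ U → (fun i => (z i).im) ∈ Γ →
      vnorm (fun i => (z i).im) < γ →
      ‖F z‖ ≤ A * Real.exp
        (AssocT (((2 : ℝ) ^ σ - 1) * τ) σ H (1 / vnorm (fun i => (z i).im))))
    (K : Set (Fin d → ℝ)) (hK : IsCompact K) (hKU : K ⊆ U)
    (φ : (Fin d → ℝ) → ℂ) (hφsm : ContDiff ℝ (⊤ : ℕ∞) φ) (hφsupp : Function.support φ ⊆ K)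
    (hφnorm : ∀ h' : ℝ, 0 < h' → GNorm (τ / (4 : ℝ) ^ (σ - 1)) σ h' K φ < ⊤)
    (Y : Fin d → ℝ) (hY : Y ∈ Γ) (hYγ : vnorm Y < γ)
    (V : Set (Fin d → ℝ)) (hVopen : IsOpen V) (hV0 : (0 : Fin d → ℝ) ∉ V)
    (hVcone : ∀ ξ ∈ V, ∀ t : ℝ, 0 < t → t • ξ ∈ V)
    (γ₁ : ℝ) (hγ₁ : 0 < γ₁)
    (hYV : ∀ ξ ∈ V, (∑ i, Y i * ξ i) ≤ -γ₁ * vnorm ξ) :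
    ∃ B c : ℝ, 0 < B ∧ 0 < c ∧
      ∀ ξ ∈ V, ∃ u : ℂ,
        Filter.Tendsto
          (fun t : ℝ =>
            ∫ x in K, F (fun i => (x i : ℂ) + (t * Y i : ℝ) * Complex.I) * φ x *
              Complex.exp (-Complex.I * (∑ i, (x i : ℂ) * (ξ i : ℂ))))
          (𝓝[>] (0 : ℝ)) (𝓝 u) ∧
        ‖u‖ ≤ B * Real.exp (-(AssocT (((2 : ℝ) ^ σ - 1) * τ) σ c (vnorm ξ))) := by
  set l : (Fin d → ℝ) → ℝ := fun ξ => ∑ i, Y i * ξ i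
  have hY0 : Y ≠ 0 := fun h => hΓ0 (h ▸ hY)
  have hy : 0 < vnorm Y := vnorm_pos hY0
  set Z : Set (Fin d → ℂ) := {z | (fun i => (z i).re) ∈ U ∧ (fun i => (z i).im) ∈ Γ ∧
    vnorm (fun i => (z i).im) < γ}
  have hrec : Continuous fun z : Fin d → ℂ => fun i => (z i).re := by fun_prop
  have himc : Continuous fun z : Fin d → ℂ => fun i => (z i).im := by fun_prop
  have hvc : Continuous fun z : Fin d → ℂ => vnorm fun i => (z i).im := continuous_vnorm.comp himc
  have hZ : IsOpen Z := (hU.preimage hrec).inter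
    ((hΓopen.preimage himc).inter (isOpen_lt hvc continuous_const))
  have hsep : ∀ z ∈ Z, ∀ j, AnalyticAt ℂ (fun w : ℂ => F (Function.update z j w)) (z j) :=
    fun z hz => hFanal z hz.1 hz.2.1 hz.2.2
  have hbdd : ∀ z ∈ Z, ∃ M, ∀ᶠ w in 𝓝 z, ‖F w‖ ≤ M := by
    intro z hz
    have hpos : 0 < vnorm fun i => (z i).im := vnorm_pos fun h => hΓ0 (h ▸ hz.2.1)
    obtain ⟨M, hM⟩ := exists_exp_assocT_le hσ hτ hH (half_pos hpos)
    refine ⟨A * M, ?_⟩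
    filter_upwards [hZ.mem_nhds hz, hvc.continuousAt.eventually (lt_mem_nhds (half_lt_self hpos))]
      with w hw hwv
    exact (hFbound w hw.1 hw.2.1 hw.2.2).trans (mul_le_mul_of_nonneg_left (hM _ hwv.le) hA.le)
  have him : ∀ x : Fin d → ℝ, ∀ s, 0 < s → vnorm (fun i => (cshift Y x s i).im) = s * vnorm Y := by
    intro x s hs
    rw [im_cshift, vnorm_smul hs.le]
  have hKZ : ∀ x ∈ K, ∀ s ∈ Set.Ioo (0 : ℝ) 1, cshift Y x s ∈ Z := by
    intro x hx s hs
    refine ⟨by rw [re_cshift]; exact hKU hx, by rw [im_cshift]; exact hΓcone Y hY s hs.1, ?_⟩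
    rw [him x s hs.1]
    nlinarith [hs.2]
  have hFK : ∀ s ∈ Set.Ioo (0 : ℝ) 1, ∀ x ∈ K, ‖F (cshift Y x s)‖ ≤
      A * Real.exp (AssocT (((2 : ℝ) ^ σ - 1) * τ) σ H (1 / (s * vnorm Y))) := by
    intro s hs x hx
    have hz := hKZ x hx s hs
    have := hFbound _ hz.1 hz.2.1 hz.2.2
    rwa [him x s hs.1] at this
  obtain ⟨C, hC0, hC⟩ := exists_norm_mder_le hσ (hφnorm 1 one_pos)
  set τ' := τ / (4 : ℝ) ^ (σ - 1) with hτ'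
  have hτ'0 : 0 < τ' := by positivity
  set b := max 1 (∑ i, |Y i|) with hb
  have hb1 : 1 ≤ b := le_max_left _ _
  have hβ : 0 < 2 * b := by linarith
  obtain ⟨B, hB0, hB⟩ := exists_exp_assocT_mul_le hσ hτ hH hy hγ₁ hβ
  set D := A * C * MeasureTheory.volume.real K with hD
  have hD0 : 0 ≤ D := by positivity
  set S := weightNode (2 * b) τ' σ with hS
  have hSpos : ∀ n, 0 < S n := weightNode_pos hβ
  have hSanti : Antitone S := weightNode_antitone hβ hτ'0 hσ
  have hS0 : S 0 < 1 := by
    have h0 : powLog σ (0 : ℕ) = 0 := by simp [powLog]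
    have h1 : powLog σ (0 + 1 : ℕ) = 0 := by simp [powLog]
    rw [hS, weightNode_eq hβ, h0, h1]
    simp only [sub_zero, mul_zero, neg_zero, Real.exp_zero, mul_one]
    exact inv_lt_one_of_one_lt₀ (by linarith)
  have hSlim := tendsto_weightNode hβ hτ'0 hσ
  have hJ : ∀ ξ k, ∀ s ∈ Set.Ioo (0 : ℝ) 1, HasDerivAt (charPairing F K φ Y ξ k)
      (-Complex.I * charPairing F K φ Y ξ (k + 1) s) s := fun ξ k s hs =>
    hasDerivAt_charPairing hZ hsep hbdd hK Y ξ hKZ hφsm hφsupp k hs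
  have hJle : ∀ ξ k, ∀ s ∈ Set.Ioo (0 : ℝ) 1, ‖charPairing F K φ Y ξ k s‖ ≤
      D * (1 / 2) ^ k * (Real.exp (AssocT (((2 : ℝ) ^ σ - 1) * τ) σ H (1 / (s * vnorm Y))) *
        (gevreyWeight (2 * b) τ' σ k * Real.exp (s * l ξ))) := by
    intro ξ k s hs
    refine (norm_charPairing_le hφsm hK ξ (hFK s hs) (M := fun n => C * Real.exp (τ' * powLog σ n))
      (fun n => by positivity) hC (le_max_right 1 _) k).trans (le_of_eq ?_)
    have h2 : (1 / 2 : ℝ) ^ k * (2 * b) ^ k = b ^ k := by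
      rw [← mul_pow]
      ring_nf
    rw [gevreyWeight, hD, ← h2]
    ring
  have hexp : ∀ ξ ∈ V, ∀ s, 0 < s → ∀ p : ℕ, Real.exp (s * l ξ) ≤
      p.factorial / (s * γ₁) ^ p * (1 / vnorm ξ ^ p) := by
    intro ξ hξ s hs p
    have hk : 0 < vnorm ξ := vnorm_pos fun h => hV0 (h ▸ hξ)
    calc Real.exp (s * l ξ) ≤ Real.exp (-(s * γ₁ * vnorm ξ)) := by
          rw [Real.exp_le_exp]; nlinarith [hYV ξ hξ]
      _ ≤ p.factorial / (s * γ₁ * vnorm ξ) ^ p :=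
          exp_neg_le_factorial_div_pow (by positivity) p
      _ = _ := by rw [mul_pow _ (vnorm ξ), div_mul_div_comm, mul_one]
  have hmain : ∀ ξ ∈ V, ∀ p : ℕ, ∀ s ∈ Set.Ioo (0 : ℝ) 1, ∀ X : ℝ, 0 ≤ X →
      (∀ r : ℕ, X ≤ gevreyWeight (2 * b) τ' σ (r + 1) * s ^ r) →
      Real.exp (AssocT (((2 : ℝ) ^ σ - 1) * τ) σ H (1 / (s * vnorm Y))) *
        (X * Real.exp (s * l ξ)) ≤
      B * Real.exp (((2 : ℝ) ^ σ - 1) * τ * powLog σ p) * (1 / vnorm ξ ^ p) := by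
    intro ξ hξ p s hs X hX hXle
    have hk : 0 < vnorm ξ := vnorm_pos fun h => hV0 (h ▸ hξ)
    calc _ ≤ Real.exp (AssocT (((2 : ℝ) ^ σ - 1) * τ) σ H (1 / (s * vnorm Y))) *
          (X * (p.factorial / (s * γ₁) ^ p * (1 / vnorm ξ ^ p))) := by
          gcongr
          exact hexp ξ hξ s hs.1 p
      _ = Real.exp (AssocT (((2 : ℝ) ^ σ - 1) * τ) σ H (1 / (s * vnorm Y))) *
          (X * (p.factorial / (s * γ₁) ^ p)) * (1 / vnorm ξ ^ p) := by ring
      _ ≤ _ := mul_le_mul_of_nonneg_right (hB s hs.1 X hX hXle p) (by positivity)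
  have hlim : ∀ ξ ∈ V, ∀ p : ℕ, ∃ u, Filter.Tendsto (charPairing F K φ Y ξ 0) (𝓝[>] 0) (𝓝 u) ∧
      ‖u‖ ≤ 5 * (D * (B * Real.exp (((2 : ℝ) ^ σ - 1) * τ * powLog σ p) *
        (1 / vnorm ξ ^ p))) := by
    intro ξ hξ p
    have hk : 0 < vnorm ξ := vnorm_pos fun h => hV0 (h ▸ hξ)
    refine exists_tendsto_of_chain hSanti hSpos hS0 hSlim (hJ ξ) ?_ ?_
    · have hs : S 0 ∈ Set.Ioo (0 : ℝ) 1 := ⟨hSpos 0, hS0⟩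
      refine (hJle ξ 0 _ hs).trans ?_
      rw [pow_zero, mul_one]
      exact mul_le_mul_of_nonneg_left (hmain ξ hξ p _ hs _ (gevreyWeight_pos hβ 0).le
        (gevreyWeight_zero_le hβ hτ'0 hσ hS0.le)) hD0
    · intro n s hs
      have hs' : s ∈ Set.Ioo (0 : ℝ) 1 := ⟨(hSpos _).trans_le hs.1,
        (hs.2.trans (hSanti n.zero_le)).trans_lt hS0⟩
      have hX := hmain ξ hξ p s hs' _ (mul_nonneg (gevreyWeight_pos hβ (n + 1)).le
        (pow_nonneg hs'.1.le n)) (gevreyWeight_mul_pow_le_succ hβ hτ'0 hσ hs.1 hs.2)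
      calc _ ≤ D * (1 / 2) ^ (n + 1) *
            (Real.exp (AssocT (((2 : ℝ) ^ σ - 1) * τ) σ H (1 / (s * vnorm Y))) *
              (gevreyWeight (2 * b) τ' σ (n + 1) * Real.exp (s * l ξ))) * s ^ n :=
            mul_le_mul_of_nonneg_right (hJle ξ (n + 1) s hs') (pow_nonneg hs'.1.le n)
        _ = D * (1 / 2) ^ (n + 1) *
            (Real.exp (AssocT (((2 : ℝ) ^ σ - 1) * τ) σ H (1 / (s * vnorm Y))) *
              (gevreyWeight (2 * b) τ' σ (n + 1) * s ^ n * Real.exp (s * l ξ))) := by ring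
        _ ≤ D * (1 / 2) ^ n * (B * Real.exp (((2 : ℝ) ^ σ - 1) * τ * powLog σ p) *
            (1 / vnorm ξ ^ p)) := by
            refine mul_le_mul ?_ hX ?_ (by positivity)
            · exact mul_le_mul_of_nonneg_left
                (pow_le_pow_of_le_one (by norm_num) (by norm_num) n.le_succ) hD0
            · have := gevreyWeight_pos (b := τ') (σ := σ) hβ (n + 1)
              have := hs'.1
              positivity
        _ = _ := by ring
  refine ⟨5 * (D * B) + 1, 1, by positivity, one_pos, fun ξ hξ => ?_⟩
  have hk : 0 < vnorm ξ := vnorm_pos fun h => hV0 (h ▸ hξ)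
  obtain ⟨u, hu, -⟩ := hlim ξ hξ 0
  have hu_le : ∀ p : ℕ, ‖u‖ ≤ 5 * (D * (B * Real.exp (((2 : ℝ) ^ σ - 1) * τ * powLog σ p) *
      (1 / vnorm ξ ^ p))) := by
    intro p
    obtain ⟨u', hu', hle⟩ := hlim ξ hξ p
    rwa [tendsto_nhds_unique hu hu']
  refine ⟨u, ?_, ?_⟩
  · have hfac : Filter.Tendsto (fun t : ℝ => Complex.exp ((-(t * l ξ) : ℝ))) (𝓝[>] 0) (𝓝 1) := by
      have hc : Continuous fun t : ℝ => Complex.exp ((-(t * l ξ) : ℝ)) := by fun_prop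
      have := hc.tendsto 0
      simp only [zero_mul, neg_zero, Complex.ofReal_zero, Complex.exp_zero] at this
      exact this.mono_left nhdsWithin_le_nhds
    have h := hfac.mul hu
    rw [one_mul] at h
    refine h.congr fun t => ?_
    rw [charPairing, ← mul_assoc, ← Complex.exp_add, ← Complex.ofReal_add, neg_add_cancel,
      Complex.ofReal_zero, Complex.exp_zero, one_mul]
    simp only [Function.iterate_zero, id, planeWave, mul_assoc]
    rfl
  · have hT := exp_assocT_mul_le (τ := ((2 : ℝ) ^ σ - 1) * τ) (X := ‖u‖) (Z := 5 * (D * B))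
      hσ one_pos hk (norm_nonneg u) (by positivity) (fun p => by
        rw [Real.one_rpow, one_mul, natCast_rpow_mul_rpow hσ, div_mul_eq_mul_div,
          div_le_iff₀ (Real.exp_pos _)]
        refine (mul_le_mul_of_nonneg_left (hu_le p) (by positivity)).trans (le_of_eq ?_)
        field_simp)
    rw [Real.exp_neg, ← div_eq_mul_inv, le_div_iff₀ (Real.exp_pos _), mul_comm]
    linarith
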